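/- There exists a constant K₀ such that for every fixed integer K ≥ K₀ and every δ > 0 there exists N₀ = N₀(K, δ) with the following property: for every N ≥ N₀, setting y = (log N)^K, every set A ⊆ S(N, y) with |A| ≥ δ·Ψ(N, y) contains a nontrivial three-term arithmetic progression, i.e., there exist integers n and d ≠ 0 with n, n+d, n+2d ∈ A. -/

import Mathlib

open scoped Classical in
/-- `S(N, y)`: the set of `y`-smooth positive integers up to `N`. -/
noncomputable def smoothSet (N : ℕ) (y : ℝ) : Finset ℕ :=
  (Finset.Icc 1 N).filter (fun n => ∀ p ∈ n.primeFactors, (p : ℝ) ≤ y)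

/-- `Ψ(N, y)`: the number of `y`-smooth positive integers up to `N`. -/
noncomputable def Psi (N : ℕ) (y : ℝ) : ℕ := (smoothSet N y).card

open Filter Topology

/-- A Fejér kernel, normalised to take the value `1` at the origin. -/
noncomputable def fejer (T u : ℝ) : ℝ := Real.sinc (T * u / 2) ^ 2

theorem fejer_nonneg (T u : ℝ) : 0 ≤ fejer T u := sq_nonneg _

theorem fejer_le_one (T u : ℝ) : fejer T u ≤ 1 := by
  have := Real.abs_sinc_le_one (T * u / 2)
  rw [fejer, ← sq_abs]
  exact pow_le_one₀ (abs_nonneg _) this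

theorem fejer_neg (T u : ℝ) : fejer T (-u) = fejer T u := by
  rw [fejer, fejer, show T * -u / 2 = -(T * u / 2) by ring, Real.sinc_neg]

theorem fejer_le_inv_sq {T u : ℝ} (hT : 0 < T) (hu : 0 < u) : fejer T u ≤ 4 / T ^ 2 / u ^ 2 := by
  have h : T * u / 2 ≠ 0 := by positivity
  rw [fejer, Real.sinc_of_ne_zero h, div_pow, div_div, ← mul_pow]
  rw [div_le_div_iff₀ (by positivity) (by positivity)]
  have := Real.sin_sq_le_one (T * u / 2)
  nlinarith [sq_nonneg (T * u)]

theorem one_third_le_fejer {T u : ℝ} (h : |T * u| ≤ 1) : 1 / 3 ≤ fejer T u := by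
  by_cases h0 : T * u / 2 = 0
  · rw [fejer, h0]; norm_num
  have hc := Real.cos_le_one_sub_mul_cos_sq (x := T * u) (h.trans (by linarith [Real.pi_gt_three]))
  have hs : Real.sin (T * u / 2) ^ 2 = 1 / 2 - Real.cos (T * u) / 2 := by
    rw [Real.sin_sq_eq_half_sub]; congr 3; ring
  rw [fejer, Real.sinc_of_ne_zero h0, div_pow, hs, le_div_iff₀ (by positivity)]
  have hp : Real.pi ^ 2 ≤ 12 := by nlinarith [Real.pi_lt_d2, Real.pi_pos]
  have : (1 : ℝ) / 6 ≤ 2 / Real.pi ^ 2 := by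
    rw [div_le_div_iff₀ (by norm_num) (by positivity)]; linarith
  nlinarith [sq_nonneg (T * u)]

theorem integral_half_triangle {T u : ℝ} (hT : 0 < T) (hu : u ≠ 0) :
    ∫ t in (0 : ℝ)..T, ((1 - t / T : ℝ) : ℂ) * Complex.exp (t * u * Complex.I) =
      (Complex.exp (T * u * Complex.I) - 1) / (T * (u * Complex.I) ^ 2) - 1 / (u * Complex.I) := by
  have hT' : (T : ℂ) ≠ 0 := by exact_mod_cast hT.ne'
  have hu' : (u : ℂ) * Complex.I ≠ 0 := mul_ne_zero (by exact_mod_cast hu) Complex.I_ne_zero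
  have hd : ∀ t ∈ Set.uIcc 0 T, HasDerivAt (fun t : ℝ => (1 - (t : ℂ) / T) *
      Complex.exp (t * (u * Complex.I)) / (u * Complex.I) +
      Complex.exp (t * (u * Complex.I)) / (T * (u * Complex.I) ^ 2))
      (((1 - t / T : ℝ) : ℂ) * Complex.exp (t * u * Complex.I)) t := by
    intro t _
    have h1 : HasDerivAt (fun t : ℝ => (t : ℂ)) 1 t := Complex.ofRealCLM.hasDerivAt
    have h2 := (h1.mul_const (u * Complex.I)).cexp
    have h3 := ((h1.div_const (T : ℂ)).const_sub 1)
    refine (((h3.mul h2).div_const (u * Complex.I)).add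
      (h2.div_const (T * (u * Complex.I) ^ 2))).congr_deriv ?_
    push_cast
    have hu2 : (u : ℂ) ≠ 0 := by exact_mod_cast hu
    have hI := Complex.I_ne_zero
    rw [← mul_assoc (t : ℂ)]
    field_simp
    ring
  rw [intervalIntegral.integral_eq_sub_of_hasDerivAt hd]
  · simp only [Complex.ofReal_zero, zero_mul, Complex.exp_zero, zero_div, div_self hT', mul_assoc]
    ring
  · apply Continuous.intervalIntegrable
    fun_prop

theorem integral_triangle_exp {T : ℝ} (hT : 0 < T) (u : ℝ) :
    ∫ t in (-T)..T, ((1 - |t| / T : ℝ) : ℂ) * Complex.exp (t * u * Complex.I) =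
      (T * fejer T u : ℝ) := by
  have hT' : (T : ℂ) ≠ 0 := by exact_mod_cast hT.ne'
  have hint : ∀ a b : ℝ, IntervalIntegrable (fun t : ℝ =>
      ((1 - |t| / T : ℝ) : ℂ) * Complex.exp (t * u * Complex.I)) MeasureTheory.volume a b := by
    intro a b
    apply Continuous.intervalIntegrable
    fun_prop
  have hpos : ∀ v : ℝ, ∫ t in (0 : ℝ)..T, ((1 - |t| / T : ℝ) : ℂ) * Complex.exp (t * v * Complex.I) =
      ∫ t in (0 : ℝ)..T, ((1 - t / T : ℝ) : ℂ) * Complex.exp (t * v * Complex.I) := by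
    intro v
    apply intervalIntegral.integral_congr
    intro t ht
    rw [Set.uIcc_of_le hT.le] at ht
    simp only [abs_of_nonneg ht.1]
  have hneg : ∫ t in (-T)..0, ((1 - |t| / T : ℝ) : ℂ) * Complex.exp (t * u * Complex.I) =
      ∫ t in (0 : ℝ)..T, ((1 - |t| / T : ℝ) : ℂ) * Complex.exp (t * (-u : ℝ) * Complex.I) := by
    have := intervalIntegral.integral_comp_neg (a := -T) (b := 0)
      (fun t : ℝ => ((1 - |t| / T : ℝ) : ℂ) * Complex.exp (t * (-u : ℝ) * Complex.I))
    simp only [neg_neg, neg_zero] at this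
    rw [← this]
    apply intervalIntegral.integral_congr
    intro t _
    simp
  rw [← intervalIntegral.integral_add_adjacent_intervals (hint (-T) 0) (hint 0 T), hneg, hpos, hpos]
  by_cases hu : u = 0
  · subst hu
    have : ∫ t in (0 : ℝ)..T, (1 - t / T : ℝ) = T / 2 := by
      rw [intervalIntegral.integral_sub (by simp) (Continuous.intervalIntegrable (by fun_prop) _ _)]
      rw [intervalIntegral.integral_div, integral_id]
      simp only [intervalIntegral.integral_const, smul_eq_mul]
      field_simp
      ring
    simp only [neg_zero, Complex.ofReal_zero, mul_zero, zero_mul, Complex.exp_zero, mul_one,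
      intervalIntegral.integral_ofReal, this, fejer]
    push_cast
    simp
  · rw [integral_half_triangle hT hu, integral_half_triangle hT (neg_ne_zero.mpr hu)]
    have hu' : (u : ℂ) ≠ 0 := by exact_mod_cast hu
    have h0 : T * u / 2 ≠ 0 := by positivity
    have hs : Real.sin (T * u / 2) ^ 2 = 1 / 2 - Real.cos (T * u) / 2 := by
      rw [Real.sin_sq_eq_half_sub]; congr 3; ring
    have he : (2 : ℂ) * (Real.cos (T * u) : ℂ) =
        Complex.exp (T * u * Complex.I) + Complex.exp (-(T * u * Complex.I)) := by
      rw [Complex.ofReal_cos, Complex.two_cos]; push_cast; congr 2; ring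
    rw [fejer, Real.sinc_of_ne_zero h0, div_pow, hs]
    push_cast
    have hc : Complex.exp (-(T * u * Complex.I)) =
        2 * Complex.cos (T * u) - Complex.exp (T * u * Complex.I) := by
      push_cast at he; rw [he]; ring
    rw [show (T : ℂ) * -u * Complex.I = -(T * u * Complex.I) by ring, hc]
    have hI : Complex.I ^ 2 = -1 := Complex.I_sq
    have hI0 := Complex.I_ne_zero
    field_simp
    rw [hI]
    ring

/-- Weight of the Bernoulli-type factor at the prime `p`. -/
noncomputable def eulerWeight (α : ℝ) (p : ℕ) : ℝ := 1 / ((p : ℝ) ^ α - 1)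

/-- The total mass of `n ^ (-α)` over the integers with all prime factors in `P`. -/
noncomputable def eulerMass (P : Finset ℕ) (α : ℝ) : ℝ := ∏ p ∈ P, (1 - (p : ℝ) ^ (-α))⁻¹

/-- The reciprocal of the characteristic function of `log n` under the normalised weights
`n ^ (-α)` on the integers with all prime factors in `P`. -/
noncomputable def invChar (P : Finset ℕ) (α t : ℝ) : ℂ :=
  ∏ p ∈ P, (1 + eulerWeight α p * (1 - Complex.exp (-(t * Real.log p * Complex.I))))

/-- The normalised weights `n ^ (-α)` on the integers with all prime factors in `P`. -/
noncomputable def smoothWeight (P : Finset ℕ) (α : ℝ) : ℕ → ℝ :=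
  (Nat.factoredNumbers P).indicator fun n => (n : ℝ) ^ (-α) / eulerMass P α

theorem eulerMass_pos {P : Finset ℕ} (hP : ∀ p ∈ P, p.Prime) {α : ℝ} (hα : 0 < α) :
    0 < eulerMass P α := by
  apply Finset.prod_pos
  intro p hp
  have h1 : (1 : ℝ) < p := by exact_mod_cast (hP p hp).one_lt
  have := Real.rpow_lt_one_of_one_lt_of_neg h1 (neg_lt_zero.mpr hα)
  rw [inv_pos]; linarith

theorem smoothWeight_nonneg {P : Finset ℕ} (hP : ∀ p ∈ P, p.Prime) {α : ℝ} (hα : 0 < α) (n : ℕ) :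
    0 ≤ smoothWeight P α n := by
  have := eulerMass_pos hP hα
  apply Set.indicator_nonneg
  intro n _
  positivity

theorem natCast_cpow_neg {n : ℕ} (hn : n ≠ 0) (α t : ℝ) :
    (n : ℂ) ^ (-(α + t * Complex.I)) =
      ((n : ℝ) ^ (-α) : ℝ) * Complex.exp (-(t * Real.log n * Complex.I)) := by
  have h0 : (n : ℂ) ≠ 0 := by exact_mod_cast hn
  have hp : (0 : ℝ) < n := by exact_mod_cast Nat.pos_of_ne_zero hn
  rw [neg_add, Complex.cpow_add _ _ h0, Complex.ofReal_cpow hp.le]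
  push_cast
  congr 1
  rw [Complex.cpow_def_of_ne_zero h0, ← Complex.natCast_log]
  congr 1; push_cast; ring

theorem hasSum_smoothWeight_mul_exp {P : Finset ℕ} (hP : ∀ p ∈ P, p.Prime) {α : ℝ} (hα : 0 < α)
    (t : ℝ) : Summable (smoothWeight P α) ∧
      HasSum (fun n : ℕ => (smoothWeight P α n : ℂ) * Complex.exp (-(t * Real.log n * Complex.I)))
        (invChar P α t)⁻¹ := by
  have hs : (α + t * Complex.I : ℂ) ≠ 0 := by
    intro h
    have := congrArg Complex.re h
    simp at this
    exact hα.ne' this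
  have hnorm : ∀ {n : ℕ}, n ≠ 0 → ‖(n : ℂ) ^ (-(α + t * Complex.I))‖ = (n : ℝ) ^ (-α) := by
    intro n hn
    rw [natCast_cpow_neg hn, norm_mul, Complex.norm_real, Real.norm_of_nonneg (by positivity)]
    rw [show -((t : ℂ) * Real.log n * Complex.I) = ((-(t * Real.log n) : ℝ) : ℂ) * Complex.I by
      push_cast; ring, Complex.norm_exp_ofReal_mul_I, mul_one]
  obtain ⟨h1, h2⟩ := EulerProduct.summable_and_hasSum_factoredNumbers_prod_filter_prime_geometric
    (f := (riemannZetaSummandHom hs : ℕ →* ℂ)) (by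
      intro p hp
      change ‖(p : ℂ) ^ (-(α + t * Complex.I))‖ < 1
      rw [hnorm hp.ne_zero]
      exact Real.rpow_lt_one_of_one_lt_of_neg (by exact_mod_cast hp.one_lt) (by linarith)) P
  have hZ := eulerMass_pos hP hα
  constructor
  · rw [smoothWeight, ← summable_subtype_iff_indicator]
    apply Summable.div_const
    refine h1.congr fun m => ?_
    exact hnorm (Nat.ne_zero_of_mem_factoredNumbers m.2)
  · have h3 := h2.mul_left ((eulerMass P α : ℂ)⁻¹)
    have h4 : (eulerMass P α : ℂ)⁻¹ * ∏ p ∈ P with p.Prime,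
        (1 - (riemannZetaSummandHom hs : ℕ →* ℂ) p)⁻¹ = (invChar P α t)⁻¹ := by
      rw [Finset.filter_true_of_mem hP, eulerMass, invChar]
      push_cast
      rw [← Finset.prod_inv_distrib, ← Finset.prod_inv_distrib, ← Finset.prod_mul_distrib]
      apply Finset.prod_congr rfl
      intro p hp
      have hp0 := (hP p hp).ne_zero
      have hp1 : (1 : ℝ) < p := by exact_mod_cast (hP p hp).one_lt
      have hb := Real.one_lt_rpow hp1 hα
      change _ * (1 - (p : ℂ) ^ (-(α + t * Complex.I)))⁻¹ = _
      rw [natCast_cpow_neg hp0, eulerWeight, ← mul_inv, Real.rpow_neg (by positivity),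
        ← Complex.natCast_log]
      generalize (p : ℝ) ^ α = b at hb
      generalize Complex.exp (-(t * Real.log p * Complex.I)) = e
      have hb0 : (b : ℂ) ≠ 0 := by exact_mod_cast (by linarith : b ≠ 0)
      have hb1 : (b : ℂ) - 1 ≠ 0 := by exact_mod_cast (sub_pos.mpr hb).ne'
      push_cast
      congr 1
      field_simp
      ring
    rw [h4] at h3
    have h5 := (hasSum_subtype_iff_indicator (f := fun m : ℕ => (eulerMass P α : ℂ)⁻¹ *
      (riemannZetaSummandHom hs : ℕ →* ℂ) m) (s := Nat.factoredNumbers P)).mp h3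
    convert h5 using 2 with n
    by_cases hn : n ∈ Nat.factoredNumbers P
    · rw [smoothWeight, Set.indicator_of_mem hn, Set.indicator_of_mem hn]
      change _ = _ * (n : ℂ) ^ (-(α + t * Complex.I))
      rw [natCast_cpow_neg (Nat.ne_zero_of_mem_factoredNumbers hn)]
      push_cast
      ring
    · rw [smoothWeight, Set.indicator_of_notMem hn, Set.indicator_of_notMem hn]
      simp

/-- The mass that the normalised weights put near `exp x`, measured with a Fejér kernel. -/
noncomputable def smoothMass (P : Finset ℕ) (α T x : ℝ) : ℝ :=
  ∑' n : ℕ, smoothWeight P α n * fejer T (x - Real.log n)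

theorem continuous_invChar (P : Finset ℕ) (α : ℝ) : Continuous (invChar P α) := by
  unfold invChar
  fun_prop

theorem norm_triangle_le {T t : ℝ} (hT : 0 < T) (ht : t ∈ Set.Ioc (-T) T) :
    ‖((1 - |t| / T : ℝ) : ℂ)‖ ≤ 1 := by
  have h1 : |t| / T ≤ 1 := by
    rw [div_le_one hT]; exact abs_le.mpr ⟨ht.1.le, ht.2⟩
  have h2 : 0 ≤ |t| / T := by positivity
  rw [Complex.norm_real, Real.norm_eq_abs, abs_le]
  constructor <;> linarith

theorem norm_exp_real_mul_I (x y : ℝ) : ‖Complex.exp (x * y * Complex.I)‖ = 1 := by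
  rw [← Complex.ofReal_mul, Complex.norm_exp_ofReal_mul_I]

theorem mul_smoothMass_eq_integral {P : Finset ℕ} (hP : ∀ p ∈ P, p.Prime) {α T : ℝ} (hα : 0 < α)
    (hT : 0 < T) (x : ℝ) :
    ((T * smoothMass P α T x : ℝ) : ℂ) = ∫ t in (-T)..T, ((1 - |t| / T : ℝ) : ℂ) *
      (Complex.exp (t * x * Complex.I) * (invChar P α t)⁻¹) := by
  have hsum := (hasSum_smoothWeight_mul_exp hP hα 0).1
  have h := intervalIntegral.hasSum_integral_of_dominated_convergence (μ := MeasureTheory.volume)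
    (a := -T) (b := T)
    (F := fun (n : ℕ) (t : ℝ) => (smoothWeight P α n : ℂ) * (((1 - |t| / T : ℝ) : ℂ) *
      Complex.exp (t * (x - Real.log n : ℝ) * Complex.I)))
    (f := fun t : ℝ => ((1 - |t| / T : ℝ) : ℂ) *
      (Complex.exp (t * x * Complex.I) * (invChar P α t)⁻¹))
    (fun n _ => smoothWeight P α n)
    (fun n => by
      apply Continuous.aestronglyMeasurable
      fun_prop)
    (fun n => Eventually.of_forall fun t ht => by
      rw [Set.uIoc_of_le (by linarith)] at ht
      rw [norm_mul, norm_mul, norm_exp_real_mul_I, mul_one, Complex.norm_real,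
        Real.norm_of_nonneg (smoothWeight_nonneg hP hα n)]
      exact mul_le_of_le_one_right (smoothWeight_nonneg hP hα n) (norm_triangle_le hT ht))
    (Eventually.of_forall fun _ _ => hsum)
    (by simp)
    (Eventually.of_forall fun t _ => by
      have := ((hasSum_smoothWeight_mul_exp hP hα t).2.mul_left
        (Complex.exp (t * x * Complex.I))).mul_left ((1 - |t| / T : ℝ) : ℂ)
      refine this.congr_fun ?_
      intro n
      rw [show (t : ℂ) * ((x - Real.log n : ℝ) : ℂ) * Complex.I =
        t * x * Complex.I + -(t * Real.log n * Complex.I) by push_cast; ring, Complex.exp_add]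
      ring)
  have h2 : ∀ n : ℕ, ∫ t in (-T)..T, (smoothWeight P α n : ℂ) * (((1 - |t| / T : ℝ) : ℂ) *
      Complex.exp (t * (x - Real.log n : ℝ) * Complex.I)) =
      ((T * (smoothWeight P α n * fejer T (x - Real.log n)) : ℝ) : ℂ) := by
    intro n
    rw [intervalIntegral.integral_const_mul, integral_triangle_exp hT]
    push_cast; ring
  simp only [h2] at h
  have h3 := Complex.hasSum_ofReal.mpr
    ((Summable.hasSum (by
      have := Complex.summable_ofReal.mp h.summable
      exact this)) :
      HasSum (fun n : ℕ => T * (smoothWeight P α n * fejer T (x - Real.log n))) _)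
  rw [smoothMass, ← tsum_mul_left]
  exact h3.unique h

/-- The integrand of the rescaled Fourier inversion formula for `smoothMass`. -/
noncomputable def massIntegrand (P : Finset ℕ) (α T σ x s : ℝ) : ℂ :=
  (Set.Ioc (-T) T).indicator (fun t : ℝ => ((1 - |t| / T : ℝ) : ℂ) *
      (Complex.exp (t * x * Complex.I) * (invChar P α t)⁻¹)) (s / σ)

theorem mul_smoothMass_eq_integral_massIntegrand {P : Finset ℕ} (hP : ∀ p ∈ P, p.Prime)
    {α T σ : ℝ} (hα : 0 < α) (hT : 0 < T) (hσ : 0 < σ) (x : ℝ) :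
    ((T * (σ * smoothMass P α T x) : ℝ) : ℂ) = ∫ s, massIntegrand P α T σ x s := by
  unfold massIntegrand
  rw [MeasureTheory.Measure.integral_comp_div, abs_of_pos hσ,
    MeasureTheory.integral_indicator measurableSet_Ioc,
    ← intervalIntegral.integral_of_le (by linarith), ← mul_smoothMass_eq_integral hP hα hT,
    Complex.real_smul]
  push_cast; ring

theorem norm_massIntegrand_le {P : Finset ℕ} {α T σ : ℝ} (hT : 0 < T) (hσ : 0 < σ) (x : ℝ)
    {g : ℝ → ℝ} (hg0 : ∀ s, 0 ≤ g s) (hg : ∀ t, |t| ≤ T → ‖(invChar P α t)⁻¹‖ ≤ g (σ * t)) (s : ℝ) :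
    ‖massIntegrand P α T σ x s‖ ≤ g s := by
  unfold massIntegrand
  by_cases hs : s / σ ∈ Set.Ioc (-T) T
  · rw [Set.indicator_of_mem hs, norm_mul, norm_mul, norm_exp_real_mul_I, one_mul]
    have h1 := hg (s / σ) (abs_le.mpr ⟨hs.1.le, hs.2⟩)
    rw [mul_div_cancel₀ _ hσ.ne'] at h1
    calc _ ≤ 1 * ‖(invChar P α ((s / σ : ℝ)))⁻¹‖ :=
          mul_le_mul_of_nonneg_right (norm_triangle_le hT hs) (norm_nonneg _)
      _ ≤ _ := by rw [one_mul]; exact h1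
  · rw [Set.indicator_of_notMem hs, norm_zero]
    exact hg0 s

theorem aestronglyMeasurable_massIntegrand (P : Finset ℕ) (α T σ x : ℝ) :
    MeasureTheory.AEStronglyMeasurable (massIntegrand P α T σ x) := by
  apply Measurable.aestronglyMeasurable
  unfold massIntegrand
  apply Measurable.comp (g := (Set.Ioc (-T) T).indicator _) _ (measurable_id.div_const σ)
  apply Measurable.indicator _ measurableSet_Ioc
  have := (continuous_invChar P α).measurable
  fun_prop

theorem smoothMass_le {P : Finset ℕ} (hP : ∀ p ∈ P, p.Prime) {α T σ : ℝ} (hα : 0 < α)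
    (hT : 0 < T) (hσ : 0 < σ) (x : ℝ) {g : ℝ → ℝ} (hg0 : ∀ s, 0 ≤ g s)
    (hgi : MeasureTheory.Integrable g)
    (hg : ∀ t, |t| ≤ T → ‖(invChar P α t)⁻¹‖ ≤ g (σ * t)) :
    σ * smoothMass P α T x ≤ (∫ s, g s) / T := by
  rw [le_div_iff₀ hT]
  have h := MeasureTheory.norm_integral_le_of_norm_le hgi
    (Eventually.of_forall (norm_massIntegrand_le (P := P) (α := α) hT hσ x hg0 hg))
  rw [← mul_smoothMass_eq_integral_massIntegrand hP hα hT hσ, Complex.norm_real] at h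
  have := (le_abs_self _).trans h
  linarith

/-- A local limit theorem. -/
theorem tendsto_smoothMass {P : ℕ → Finset ℕ} {α σ τ : ℕ → ℝ} {T h : ℝ}
    (hP : ∀ N, ∀ p ∈ P N, p.Prime) (hα : ∀ᶠ N in atTop, 0 < α N) (hT : 0 < T)
    (hσ : Tendsto σ atTop atTop) {g : ℝ → ℝ} (hg0 : ∀ s, 0 ≤ g s)
    (hgi : MeasureTheory.Integrable g)
    (hg : ∀ᶠ N in atTop, ∀ t, |t| ≤ T → ‖(invChar (P N) (α N) t)⁻¹‖ ≤ g (σ N * t))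
    (hlim : ∀ s : ℝ, Tendsto (fun N => Complex.exp ((s / σ N : ℝ) * τ N * Complex.I) *
      (invChar (P N) (α N) (s / σ N))⁻¹) atTop (𝓝 (Real.exp (-(1 / 2) * s ^ 2) : ℝ))) :
    Tendsto (fun N => σ N * smoothMass (P N) (α N) T (τ N - h)) atTop
      (𝓝 (√(Real.pi / (1 / 2)) / T)) := by
  have key := MeasureTheory.tendsto_integral_filter_of_dominated_convergence
    (μ := MeasureTheory.volume) (l := atTop)
    (F := fun N s => massIntegrand (P N) (α N) T (σ N) (τ N - h) s)
    (f := fun s => ((Real.exp (-(1 / 2) * s ^ 2) : ℝ) : ℂ)) g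
    (Eventually.of_forall fun N => aestronglyMeasurable_massIntegrand _ _ _ _ _)
    (by
      filter_upwards [hg, hσ.eventually_gt_atTop 0] with N h1 h2
      exact Eventually.of_forall (norm_massIntegrand_le hT h2 _ hg0 h1))
    hgi
    (Eventually.of_forall fun s => by
      have e0 : Tendsto (fun N => s / σ N) atTop (𝓝 0) := hσ.const_div_atTop s
      have e1 : Tendsto (fun N => ((1 - |s / σ N| / T : ℝ) : ℂ)) atTop (𝓝 1) := by
        have : Tendsto (fun N => 1 - |s / σ N| / T) atTop (𝓝 (1 - |0| / T)) :=
          (e0.abs.div_const T).const_sub 1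
        rw [abs_zero, zero_div, sub_zero] at this
        exact_mod_cast (Complex.continuous_ofReal.tendsto _).comp this
      have e2 : Tendsto (fun N => Complex.exp ((-(s / σ N * h) : ℝ) * Complex.I)) atTop (𝓝 1) := by
        have : Tendsto (fun N => Complex.exp ((-(s / σ N * h) : ℝ) * Complex.I)) atTop
            (𝓝 (Complex.exp ((-(0 * h) : ℝ) * Complex.I))) :=
          Tendsto.comp (f := fun N => s / σ N)
            (g := fun u : ℝ => Complex.exp ((-(u * h) : ℝ) * Complex.I))
            (Continuous.tendsto (by fun_prop) 0) e0
        simpa using this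
      have e3 := (e1.mul e2).mul (hlim s)
      rw [one_mul, one_mul] at e3
      refine e3.congr' ?_
      filter_upwards [e0.eventually (Ioo_mem_nhds (neg_lt_zero.mpr hT) hT)] with N hN
      have hN2 : s / σ N ∈ Set.Ioc (-T) T := ⟨hN.1, hN.2.le⟩
      rw [massIntegrand, Set.indicator_of_mem hN2]
      rw [show ((s / σ N : ℝ) : ℂ) * ((τ N - h : ℝ) : ℂ) * Complex.I =
        (-(s / σ N * h) : ℝ) * Complex.I + (s / σ N : ℝ) * τ N * Complex.I by push_cast; ring,
        Complex.exp_add]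
      ring)
  rw [integral_complex_ofReal, integral_gaussian] at key
  have key2 : Tendsto (fun N => ((T * (σ N * smoothMass (P N) (α N) T (τ N - h)) : ℝ) : ℂ)) atTop
      (𝓝 ((√(Real.pi / (1 / 2)) : ℝ) : ℂ)) := by
    refine key.congr' ?_
    filter_upwards [hα, hσ.eventually_gt_atTop 0] with N h1 h2
    rw [mul_smoothMass_eq_integral_massIntegrand (hP N) h1 hT h2]
  have key3 := (Complex.continuous_re.tendsto _).comp key2
  simp only [Function.comp_def, Complex.ofReal_re] at key3
  refine (key3.div_const T).congr fun N => ?_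
  field_simp

/-- The mean of `log n` under the normalised weights. -/
noncomputable def logMean (P : Finset ℕ) (α : ℝ) : ℝ := ∑ p ∈ P, eulerWeight α p * Real.log p

/-- The variance of `log n` under the normalised weights. -/
noncomputable def logVar (P : Finset ℕ) (α : ℝ) : ℝ :=
  ∑ p ∈ P, (eulerWeight α p + eulerWeight α p ^ 2) * Real.log p ^ 2

theorem norm_sq_one_add_mul_one_sub_exp (b θ : ℝ) :
    ‖1 + (b : ℂ) * (1 - Complex.exp (-(θ * Complex.I)))‖ ^ 2 =
      1 + 2 * (b + b ^ 2) * (1 - Real.cos θ) := by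
  rw [← Complex.normSq_eq_norm_sq, show -((θ : ℂ) * Complex.I) = ((-θ : ℝ) : ℂ) * Complex.I by
    push_cast; ring, Complex.exp_mul_I, ← Complex.ofReal_cos, ← Complex.ofReal_sin,
    Complex.normSq_apply]
  simp [-Complex.ofReal_cos, -Complex.ofReal_sin]
  have := Real.sin_sq_add_cos_sq θ
  linear_combination b ^ 2 * this

theorem inv_norm_one_add_le {b : ℝ} (hb : 0 ≤ b) (hb3 : b ≤ 3) (θ : ℝ) :
    ‖1 + (b : ℂ) * (1 - Complex.exp (-(θ * Complex.I)))‖⁻¹ ≤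
      Real.exp (-(1 / 49 * ((b + b ^ 2) * (1 - Real.cos θ)))) := by
  have h := norm_sq_one_add_mul_one_sub_exp b θ
  set r := ‖1 + (b : ℂ) * (1 - Complex.exp (-(θ * Complex.I)))‖
  have hr0 : 0 ≤ r := norm_nonneg _
  have hc0 : 0 ≤ 1 - Real.cos θ := by linarith [Real.cos_le_one θ]
  have hc2 : 1 - Real.cos θ ≤ 2 := by linarith [Real.neg_one_le_cos θ]
  set x := (b + b ^ 2) * (1 - Real.cos θ) with hx
  have hx0 : 0 ≤ x := by positivity
  have hx24 : x ≤ 24 := by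
    calc x ≤ 12 * 2 := mul_le_mul (by nlinarith) hc2 hc0 (by norm_num)
      _ = 24 := by norm_num
  have h1 : r ^ 2 = 1 + 2 * x := by rw [h, hx]; ring
  have hrpos : 0 < r := by nlinarith
  have h2 := Real.one_sub_inv_le_log_of_pos (x := r ^ 2) (by positivity)
  rw [Real.log_pow] at h2
  have h3 : 2 / 49 * x ≤ 1 - (r ^ 2)⁻¹ := by
    rw [h1, ← sub_nonneg]
    have : 1 - (1 + 2 * x)⁻¹ - 2 / 49 * x = 4 * x * (24 - x) / 49 / (1 + 2 * x) := by
      field_simp; ring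
    rw [this]
    have : 0 ≤ 24 - x := by linarith
    positivity
  push_cast at h2
  rw [Real.exp_neg]
  apply inv_anti₀ (Real.exp_pos _)
  rw [← Real.le_log_iff_exp_le hrpos]
  linarith

theorem norm_inv_invChar_le {P : Finset ℕ} {α : ℝ}
    (hb : ∀ p ∈ P, 0 ≤ eulerWeight α p ∧ eulerWeight α p ≤ 3) (t : ℝ) :
    ‖(invChar P α t)⁻¹‖ ≤ Real.exp (-(1 / 49 * ∑ p ∈ P,
      (eulerWeight α p + eulerWeight α p ^ 2) * (1 - Real.cos (t * Real.log p)))) := by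
  rw [norm_inv, invChar, norm_prod, ← Finset.prod_inv_distrib, Finset.mul_sum,
    ← Finset.sum_neg_distrib, Real.exp_sum]
  apply Finset.prod_le_prod
  · intros; positivity
  · intro p hp
    have := inv_norm_one_add_le (hb p hp).1 (hb p hp).2 (t * Real.log p)
    push_cast at this ⊢
    exact this

theorem sq_div_five_le_one_sub_cos {θ : ℝ} (h : |θ| ≤ 1) : θ ^ 2 / 5 ≤ 1 - Real.cos θ := by
  have hc := Real.cos_le_one_sub_mul_cos_sq (x := θ) (h.trans (by linarith [Real.pi_gt_three]))
  have hp : Real.pi ^ 2 ≤ 10 := by nlinarith [Real.pi_lt_d2, Real.pi_pos]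
  have : (1 : ℝ) / 5 ≤ 2 / Real.pi ^ 2 := by
    rw [div_le_div_iff₀ (by norm_num) (by positivity)]; linarith
  nlinarith [sq_nonneg θ]

theorem norm_inv_invChar_le_of_small {P : Finset ℕ} {α ℓ t : ℝ}
    (hb : ∀ p ∈ P, 0 ≤ eulerWeight α p ∧ eulerWeight α p ≤ 3)
    (hℓ : ∀ p ∈ P, Real.log p ≤ ℓ) (ht : |t| * ℓ ≤ 1) :
    ‖(invChar P α t)⁻¹‖ ≤ Real.exp (-(logVar P α * t ^ 2 / 245)) := by
  refine (norm_inv_invChar_le hb t).trans (Real.exp_le_exp.mpr (neg_le_neg ?_))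
  rw [logVar, Finset.sum_mul, Finset.sum_div, Finset.mul_sum]
  apply Finset.sum_le_sum
  intro p hp
  have h1 : |t * Real.log p| ≤ 1 := by
    rw [abs_mul, abs_of_nonneg (Real.log_natCast_nonneg p)]
    exact (mul_le_mul_of_nonneg_left (hℓ p hp) (abs_nonneg t)).trans ht
  have h2 := sq_div_five_le_one_sub_cos h1
  have h3 : 0 ≤ eulerWeight α p + eulerWeight α p ^ 2 := by
    have := (hb p hp).1; positivity
  nlinarith [mul_le_mul_of_nonneg_left h2 h3]

theorem exists_one_add_eq_exp {b θ : ℝ} (hb : 0 ≤ b) (hb3 : b ≤ 3) (hθ : |θ| ≤ 1 / 6) :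
    ∃ E : ℂ, ‖E‖ ≤ 12 * b * |θ| ^ 3 ∧ 1 + (b : ℂ) * (1 - Complex.exp (-(θ * Complex.I))) =
      Complex.exp (b * θ * Complex.I + (b + b ^ 2) * θ ^ 2 / 2 + E) := by
  set z : ℂ := (b : ℂ) * (1 - Complex.exp (-(θ * Complex.I))) with hz
  have hθ0 := abs_nonneg θ
  have hnI : ‖-((θ : ℂ) * Complex.I)‖ = |θ| := by simp
  obtain ⟨r, hr⟩ : ∃ r : ℂ, r = Complex.exp (-(θ * Complex.I)) -
    ∑ m ∈ Finset.range 3, (-(θ * Complex.I)) ^ m / m.factorial := ⟨_, rfl⟩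
  have hrb : ‖r‖ ≤ 2 / 9 * |θ| ^ 3 := by
    have := Complex.exp_bound (x := -((θ : ℂ) * Complex.I)) (by rw [hnI]; linarith) (n := 3)
      (by norm_num)
    rw [← hr, hnI] at this
    norm_num [Nat.factorial] at this
    linarith
  have hI := Complex.I_sq
  have hexp : Complex.exp (-(θ * Complex.I)) = 1 - θ * Complex.I - θ ^ 2 / 2 + r := by
    rw [hr]; simp [Finset.sum_range_succ, Nat.factorial]
    linear_combination (θ ^ 2 / 2 : ℂ) * hI
  set w : ℂ := b * (θ ^ 2 / 2 - r) with hw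
  have hzw : z = b * θ * Complex.I + w := by rw [hz, hexp, hw]; ring
  have hwb : ‖w‖ ≤ b * |θ| ^ 2 * (5 / 9) := by
    have h1 : ‖(θ : ℂ) ^ 2 / 2 - r‖ ≤ |θ| ^ 2 / 2 + 2 / 9 * |θ| ^ 3 := by
      refine (norm_sub_le _ _).trans (add_le_add ?_ hrb)
      simp
    rw [hw, norm_mul, Complex.norm_real, Real.norm_of_nonneg hb, mul_assoc]
    apply mul_le_mul_of_nonneg_left _ hb
    nlinarith [sq_nonneg |θ|]
  have hbt : ‖(b : ℂ) * θ * Complex.I‖ = b * |θ| := by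
    simp [abs_of_nonneg hb]
  have hzb : ‖z‖ ≤ b * |θ| * (11 / 10) := by
    rw [hzw]
    refine (norm_add_le _ _).trans ?_
    rw [hbt]
    have : 0 ≤ b * |θ| := by positivity
    nlinarith
  have hz1 : ‖z‖ ≤ 11 / 20 := by
    refine hzb.trans ?_
    nlinarith
  have hlog := Complex.norm_log_sub_logTaylor_le 2 (z := z) (by linarith)
  have hT : Complex.logTaylor 3 z = z - z ^ 2 / 2 := by
    simp [Complex.logTaylor, Finset.sum_range_succ]
    ring
  rw [show 2 + 1 = 3 from rfl, hT] at hlog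
  have hinv : (1 - ‖z‖)⁻¹ ≤ 20 / 9 := by
    rw [inv_le_comm₀ (by linarith) (by norm_num)]; linarith
  have hz3 : ‖z‖ ^ 3 ≤ (b * |θ| * (11 / 10)) ^ 3 := pow_le_pow_left₀ (norm_nonneg _) hzb 3
  have hne : 1 + z ≠ 0 := by
    intro h
    have : z = -1 := by linear_combination h
    rw [this] at hz1; norm_num at hz1
  refine ⟨Complex.log (1 + z) - (b * θ * Complex.I + (b + b ^ 2) * θ ^ 2 / 2), ?_, ?_⟩
  · have hsplit : Complex.log (1 + z) - (b * θ * Complex.I + (b + b ^ 2) * θ ^ 2 / 2) =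
        (Complex.log (1 + z) - (z - z ^ 2 / 2)) + (-(b * r) - (b * θ * Complex.I * w + w ^ 2 / 2)) := by
      have hw' : w = b * (θ ^ 2 / 2 - r) := rfl
      rw [hzw]
      linear_combination hw' - (b ^ 2 * θ ^ 2 / 2 : ℂ) * hI
    rw [hsplit]
    have n1 : ‖Complex.log (1 + z) - (z - z ^ 2 / 2)‖ ≤ (b * |θ| * (11 / 10)) ^ 3 * (20 / 9) / 3 := by
      refine hlog.trans ?_
      push_cast
      rw [show (2 : ℝ) + 1 = 3 by norm_num]
      gcongr
      · have : 0 < 1 - ‖z‖ := by linarith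
        positivity
    have n2 : ‖(b : ℂ) * r‖ ≤ b * (2 / 9 * |θ| ^ 3) := by
      rw [norm_mul, Complex.norm_real, Real.norm_of_nonneg hb]
      exact mul_le_mul_of_nonneg_left hrb hb
    have n3 : ‖(b : ℂ) * θ * Complex.I * w‖ ≤ b * |θ| * (b * |θ| ^ 2 * (5 / 9)) := by
      rw [norm_mul, hbt]
      gcongr
    have n4 : ‖w ^ 2 / 2‖ ≤ (b * |θ| ^ 2 * (5 / 9)) ^ 2 / 2 := by
      rw [norm_div, norm_pow]
      simp only [Complex.norm_ofNat]
      gcongr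
    calc _ ≤ (b * |θ| * (11 / 10)) ^ 3 * (20 / 9) / 3 + (b * (2 / 9 * |θ| ^ 3) +
          (b * |θ| * (b * |θ| ^ 2 * (5 / 9)) + (b * |θ| ^ 2 * (5 / 9)) ^ 2 / 2)) := by
          refine (norm_add_le _ _).trans (add_le_add n1 ((norm_sub_le _ _).trans
            (add_le_add ?_ ((norm_add_le _ _).trans (add_le_add n3 n4)))))
          rw [norm_neg]; exact n2
      _ = (b * |θ| ^ 3) * ((11 / 10) ^ 3 * (20 / 27) * b ^ 2 + 2 / 9 + 5 / 9 * b +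
          25 / 162 * b * |θ|) := by ring
      _ ≤ (b * |θ| ^ 3) * 12 := by
          apply mul_le_mul_of_nonneg_left _ (by positivity)
          have h1 : b ^ 2 ≤ 9 := by nlinarith
          have h2 : b * |θ| ≤ 3 * (1 / 6) := mul_le_mul hb3 hθ hθ0 (by norm_num)
          linarith
      _ = _ := by ring
  · rw [add_sub_cancel, Complex.exp_log hne]

theorem exists_invChar_eq_exp {P : Finset ℕ} {α ℓ t : ℝ}
    (hb : ∀ p ∈ P, 0 ≤ eulerWeight α p ∧ eulerWeight α p ≤ 3)
    (hℓ : ∀ p ∈ P, Real.log p ≤ ℓ) (ht : |t| * ℓ ≤ 1 / 6) :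
    ∃ E : ℂ, ‖E‖ ≤ 12 * |t| ^ 3 * ℓ * logVar P α ∧ invChar P α t =
      Complex.exp (t * logMean P α * Complex.I + logVar P α * t ^ 2 / 2 + E) := by
  have h : ∀ p ∈ P, ∃ E : ℂ, ‖E‖ ≤ 12 * eulerWeight α p * |t * Real.log p| ^ 3 ∧
      1 + (eulerWeight α p : ℂ) * (1 - Complex.exp (-(((t * Real.log p : ℝ) : ℂ) * Complex.I))) =
      Complex.exp (eulerWeight α p * (t * Real.log p : ℝ) * Complex.I +
        (eulerWeight α p + eulerWeight α p ^ 2) * (t * Real.log p : ℝ) ^ 2 / 2 + E) := by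
    intro p hp
    apply exists_one_add_eq_exp (hb p hp).1 (hb p hp).2
    rw [abs_mul, abs_of_nonneg (Real.log_natCast_nonneg p)]
    exact (mul_le_mul_of_nonneg_left (hℓ p hp) (abs_nonneg t)).trans ht
  choose! E hE1 hE2 using h
  refine ⟨∑ p ∈ P, E p, ?_, ?_⟩
  · refine (norm_sum_le _ _).trans ?_
    rw [logVar, Finset.mul_sum]
    apply Finset.sum_le_sum
    intro p hp
    refine (hE1 p hp).trans ?_
    have hl := Real.log_natCast_nonneg p
    rw [abs_mul, abs_of_nonneg hl, mul_pow]
    have h0 := (hb p hp).1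
    calc _ = 12 * |t| ^ 3 * Real.log p * (eulerWeight α p * Real.log p ^ 2) := by ring
      _ ≤ 12 * |t| ^ 3 * ℓ * ((eulerWeight α p + eulerWeight α p ^ 2) * Real.log p ^ 2) := by
        have := hℓ p hp
        have : 0 ≤ ℓ := hl.trans this
        gcongr
        · nlinarith
  · rw [invChar, logMean, logVar]
    push_cast
    rw [Finset.mul_sum, Finset.sum_mul, Finset.sum_mul, Finset.sum_div, ← Finset.sum_add_distrib,
      ← Finset.sum_add_distrib, Complex.exp_sum]
    apply Finset.prod_congr rfl
    intro p hp
    have := hE2 p hp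
    push_cast at this
    rw [this]
    congr 1
    ring

theorem tendsto_exp_mul_inv_invChar {P : ℕ → Finset ℕ} {α σ ℓ : ℕ → ℝ}
    (hb : ∀ᶠ N in atTop, ∀ p ∈ P N, 0 ≤ eulerWeight (α N) p ∧ eulerWeight (α N) p ≤ 3)
    (hℓ : ∀ᶠ N in atTop, ∀ p ∈ P N, Real.log p ≤ ℓ N)
    (hσ : ∀ᶠ N in atTop, 0 < σ N ∧ σ N ^ 2 = logVar (P N) (α N))
    (hℓσ : Tendsto (fun N => ℓ N / σ N) atTop (𝓝 0)) (s : ℝ) :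
    Tendsto (fun N => Complex.exp ((s / σ N : ℝ) * logMean (P N) (α N) * Complex.I) *
      (invChar (P N) (α N) (s / σ N))⁻¹) atTop (𝓝 (Real.exp (-(1 / 2) * s ^ 2) : ℝ)) := by
  have hsmall : ∀ᶠ N in atTop, |s / σ N| * ℓ N ≤ 1 / 6 := by
    have h1 : Tendsto (fun N => |s| * (ℓ N / σ N)) atTop (𝓝 (|s| * 0)) := hℓσ.const_mul _
    rw [mul_zero] at h1
    filter_upwards [h1.eventually_lt_const (by norm_num : (0 : ℝ) < 1 / 6), hσ] with N h2 h3
    rw [abs_div, abs_of_pos h3.1, div_mul_eq_mul_div, ← mul_div_assoc'] at *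
    exact h2.le
  have hE : ∀ᶠ N in atTop, ∃ E : ℂ, ‖E‖ ≤ 12 * |s| ^ 3 * (ℓ N / σ N) ∧
      Complex.exp ((s / σ N : ℝ) * logMean (P N) (α N) * Complex.I) *
      (invChar (P N) (α N) (s / σ N))⁻¹ = Complex.exp (-(s ^ 2 / 2) - E) := by
    filter_upwards [hb, hℓ, hσ, hsmall] with N h1 h2 h3 h4
    obtain ⟨E, hE1, hE2⟩ := exists_invChar_eq_exp h1 h2 h4
    refine ⟨E, hE1.trans (le_of_eq ?_), ?_⟩
    · have := h3.1.ne'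
      rw [← h3.2, abs_div, abs_of_pos h3.1]
      field_simp
    · rw [hE2, ← Complex.exp_neg, ← Complex.exp_add]
      congr 1
      have : (σ N : ℂ) ≠ 0 := by exact_mod_cast h3.1.ne'
      rw [← h3.2]
      push_cast
      field_simp
      ring
  rw [Metric.tendsto_nhds]
  intro ε hε
  have hcont : ContinuousAt (fun E : ℂ => Complex.exp (-(s ^ 2 / 2) - E)) 0 := by fun_prop
  obtain ⟨η, hη, hη2⟩ := Metric.continuousAt_iff.mp hcont ε hε
  have h1 : Tendsto (fun N => 12 * |s| ^ 3 * (ℓ N / σ N)) atTop (𝓝 (12 * |s| ^ 3 * 0)) :=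
    hℓσ.const_mul _
  rw [mul_zero] at h1
  filter_upwards [hE, h1.eventually_lt_const hη] with N ⟨E, hE1, hE2⟩ hN
  rw [hE2]
  have h2 := hη2 (x := E) (by rw [dist_zero_right]; exact hE1.trans_lt hN)
  rw [sub_zero] at h2
  convert h2 using 2
  push_cast
  congr 1; ring

/-- The primes up to a real number. -/
noncomputable def primesUpTo (y : ℝ) : Finset ℕ := ⌊y⌋₊.primesLE

theorem mem_primesUpTo {y : ℝ} (hy : 0 ≤ y) {p : ℕ} :
    p ∈ primesUpTo y ↔ (p : ℝ) ≤ y ∧ p.Prime := by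
  rw [primesUpTo, Nat.mem_primesLE, Nat.le_floor_iff hy]

theorem prime_of_mem_primesUpTo {y : ℝ} {p : ℕ} (hp : p ∈ primesUpTo y) : p.Prime :=
  Nat.prime_of_mem_primesLE hp

theorem primesUpTo_mono {x y : ℝ} (h : x ≤ y) : primesUpTo x ⊆ primesUpTo y := by
  intro p hp
  rw [primesUpTo, Nat.mem_primesLE] at *
  exact ⟨hp.1.trans (Nat.floor_mono h), hp.2⟩

theorem sum_log_primesUpTo (y : ℝ) : ∑ p ∈ primesUpTo y, Real.log p = Chebyshev.theta y :=
  (Chebyshev.theta_eq_sum_primesLE y).symm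

theorem eventually_half_le_theta : ∀ᶠ x : ℝ in atTop, x / 2 ≤ Chebyshev.theta x := by
  have h := (isLittleO_log_rpow_atTop (r := 1 / 2) (by norm_num)).bound
    (by norm_num : (0 : ℝ) < 1 / 25)
  filter_upwards [h, eventually_ge_atTop 100] with x hx hx1
  refine le_trans ?_ (Chebyshev.theta_ge' (by linarith))
  rw [← Real.sqrt_eq_rpow, Real.norm_of_nonneg (Real.log_nonneg (by linarith)),
    Real.norm_of_nonneg (Real.sqrt_nonneg _)] at hx
  have h2 : Real.log (x + 2) ≤ 2 * Real.log x := by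
    rw [← Real.log_rpow (by linarith)]
    apply Real.log_le_log (by linarith)
    norm_num; nlinarith
  have hs : √x * √x = x := Real.mul_self_sqrt (by linarith)
  have hs1 : 10 ≤ √x := by rw [Real.le_sqrt' (by norm_num)]; linarith
  have h3 := Real.log_two_gt_d9
  nlinarith

theorem eventually_le_sum_log_sdiff : ∀ᶠ v : ℝ in atTop,
    v ≤ ∑ p ∈ primesUpTo (8 * v) \ primesUpTo v, Real.log p := by
  have h : Tendsto (fun v : ℝ => 8 * v) atTop atTop := tendsto_id.const_mul_atTop (by norm_num)
  filter_upwards [h.eventually eventually_half_le_theta, eventually_ge_atTop 0] with v h1 h2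
  have h3 := Chebyshev.theta_le_log4_mul_x h2
  have h4 : Real.log 4 ≤ 1.4 := by
    rw [show (4 : ℝ) = 2 ^ 2 by norm_num, Real.log_pow]
    have := Real.log_two_lt_d9
    push_cast; linarith
  have h5 := Finset.sum_sdiff (f := fun p : ℕ => Real.log p)
    (primesUpTo_mono (by linarith : v ≤ 8 * v))
  rw [sum_log_primesUpTo, sum_log_primesUpTo] at h5
  nlinarith

theorem eulerWeight_bounds {α : ℝ} (hα : 1 / 2 ≤ α) {p : ℕ} (hp : p.Prime) :
    (p : ℝ) ^ (-α) ≤ eulerWeight α p ∧ eulerWeight α p ≤ 4 * (p : ℝ) ^ (-α) ∧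
      0 ≤ eulerWeight α p ∧ eulerWeight α p ≤ 3 := by
  have hp2 : (2 : ℝ) ≤ p := by exact_mod_cast hp.two_le
  have h1 : (4 : ℝ) / 3 ≤ (p : ℝ) ^ α := by
    calc (4 : ℝ) / 3 ≤ √2 := by rw [Real.le_sqrt' (by norm_num)]; norm_num
      _ = 2 ^ (1 / 2 : ℝ) := Real.sqrt_eq_rpow _
      _ ≤ (p : ℝ) ^ (1 / 2 : ℝ) := Real.rpow_le_rpow (by norm_num) hp2 (by norm_num)
      _ ≤ (p : ℝ) ^ α := Real.rpow_le_rpow_of_exponent_le (by linarith) hα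
  rw [eulerWeight, Real.rpow_neg (by linarith)]
  generalize (p : ℝ) ^ α = b at h1
  have hb : 0 < b - 1 := by linarith
  refine ⟨?_, ?_, by positivity, ?_⟩
  · rw [inv_eq_one_div]; exact one_div_le_one_div_of_le hb (by linarith)
  · rw [← div_eq_mul_inv, div_le_div_iff₀ hb (by linarith)]; linarith
  · rw [div_le_iff₀ hb]; linarith

theorem continuousOn_logMean {P : Finset ℕ} (hP : ∀ p ∈ P, p.Prime) (a b : ℝ) (ha : 0 < a) :
    ContinuousOn (logMean P) (Set.Icc a b) := by
  unfold logMean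
  apply continuousOn_finsetSum
  intro p hp
  have hp1 : (1 : ℝ) < p := by exact_mod_cast (hP p hp).one_lt
  apply ContinuousOn.mul _ continuousOn_const
  unfold eulerWeight
  apply ContinuousOn.div continuousOn_const
  · apply ContinuousOn.sub _ continuousOn_const
    apply Continuous.continuousOn
    exact Real.continuous_const_rpow (by linarith)
  · intro x hx
    have := Real.one_lt_rpow hp1 (lt_of_lt_of_le ha hx.1)
    linarith

theorem le_logMean_half {y : ℝ} (hy : 0 < y) (h : y / 2 ≤ Chebyshev.theta y) :
    √y / 2 ≤ logMean (primesUpTo y) (1 / 2) := by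
  have hs : √y * √y = y := Real.mul_self_sqrt hy.le
  have hs0 : 0 < √y := Real.sqrt_pos.mpr hy
  calc √y / 2 = y / 2 / √y := by field_simp; linarith
    _ ≤ Chebyshev.theta y / √y := by gcongr
    _ ≤ _ := by
      rw [← sum_log_primesUpTo, logMean, Finset.sum_div]
      apply Finset.sum_le_sum
      intro p hp
      rw [div_eq_mul_inv, mul_comm]
      apply mul_le_mul_of_nonneg_right _ (Real.log_natCast_nonneg p)
      refine le_trans ?_ (eulerWeight_bounds le_rfl (prime_of_mem_primesUpTo hp)).1
      have hp' := (mem_primesUpTo hy.le).mp hp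
      have : (0 : ℝ) < p := by exact_mod_cast hp'.2.pos
      rw [Real.rpow_neg this.le, ← Real.sqrt_eq_rpow]
      apply inv_anti₀ (Real.sqrt_pos.mpr this)
      exact Real.sqrt_le_sqrt hp'.1

theorem logMean_le {y κ : ℝ} (hy : 1 ≤ y) (hκ0 : 0 ≤ κ) (hκ : κ ≤ 1 / 2) :
    logMean (primesUpTo y) (1 - κ) ≤ 4 * Real.log y * (1 + Real.log y) * y ^ κ := by
  have hl : 0 ≤ Real.log y := Real.log_nonneg hy
  have h1 : ∀ p ∈ primesUpTo y, eulerWeight (1 - κ) p * Real.log p ≤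
      4 * Real.log y * y ^ κ * (p : ℝ)⁻¹ := by
    intro p hp
    have hp' := (mem_primesUpTo (by linarith)).mp hp
    have hp0 : (0 : ℝ) < p := by exact_mod_cast hp'.2.pos
    have h2 := (eulerWeight_bounds (α := 1 - κ) (by linarith) hp'.2).2.1
    have h3 : (p : ℝ) ^ (-(1 - κ)) ≤ y ^ κ * (p : ℝ)⁻¹ := by
      rw [show -(1 - κ) = κ + -1 by ring, Real.rpow_add hp0, Real.rpow_neg_one]
      gcongr
      exact hp'.1
    calc _ ≤ (4 * (y ^ κ * (p : ℝ)⁻¹)) * Real.log y := by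
          gcongr
          · linarith
          · exact hp'.1
      _ = _ := by ring
  rw [logMean]
  refine (Finset.sum_le_sum h1).trans ?_
  rw [← Finset.mul_sum]
  have h4 : ∑ p ∈ primesUpTo y, (p : ℝ)⁻¹ ≤ 1 + Real.log y := by
    have := harmonic_floor_le_one_add_log y hy
    refine le_trans ?_ this
    rw [harmonic_eq_sum_Icc]
    push_cast
    apply Finset.sum_le_sum_of_subset_of_nonneg
    · intro p hp
      rw [primesUpTo, Nat.mem_primesLE] at hp
      exact Finset.mem_Icc.mpr ⟨hp.2.one_le, hp.1⟩
    · intros; positivity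
  calc _ ≤ 4 * Real.log y * y ^ κ * (1 + Real.log y) := by gcongr
    _ = _ := by ring

theorem one_sub_cos_sub_le (a b : ℝ) :
    (1 - Real.cos (a - b)) / 2 ≤ (1 - Real.cos a) + (1 - Real.cos b) := by
  have h : ∀ x : ℝ, 1 - Real.cos x = 2 * Real.sin (x / 2) ^ 2 := by
    intro x; rw [Real.sin_sq_eq_half_sub, mul_div_cancel₀ _ (by norm_num)]; ring
  rw [h, h, h, show (a - b) / 2 = a / 2 - b / 2 by ring, Real.sin_sub]
  have h1 := Real.sin_sq_add_cos_sq (a / 2)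
  have h2 := Real.sin_sq_add_cos_sq (b / 2)
  generalize Real.sin (a / 2) = s at *
  generalize Real.cos (a / 2) = c at *
  generalize Real.sin (b / 2) = s' at *
  generalize Real.cos (b / 2) = c' at *
  have e1 : c ^ 2 ≤ 1 := by nlinarith [sq_nonneg s]
  have e2 : c' ^ 2 ≤ 1 := by nlinarith [sq_nonneg s']
  nlinarith [sq_nonneg (s * c' + c * s'), mul_le_mul_of_nonneg_left e1 (sq_nonneg s'),
    mul_le_mul_of_nonneg_left e2 (sq_nonneg s)]

theorem sum_mul_one_sub_cos_ge {v α S t : ℝ} (hv : 0 < v) (hS : 0 ≤ S) (ht : |t| ≤ 1 / 7)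
    (hα : 1 / 2 ≤ α)
    (h1 : S ≤ ∑ p ∈ primesUpTo (8 * v) \ primesUpTo v, eulerWeight α p)
    (h2 : S ≤ ∑ p ∈ primesUpTo (512 * v) \ primesUpTo (64 * v), eulerWeight α p) :
    S * t ^ 2 / 4 ≤ ∑ p ∈ primesUpTo (512 * v),
      (eulerWeight α p + eulerWeight α p ^ 2) * (1 - Real.cos (t * Real.log p)) := by
  set G := primesUpTo (8 * v) \ primesUpTo v with hG
  set H := primesUpTo (512 * v) \ primesUpTo (64 * v) with hH
  set f : ℕ → ℝ := fun p => 1 - Real.cos (t * Real.log p) with hf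
  have hf0 : ∀ p, 0 ≤ f p := fun p => by simp only [hf]; linarith [Real.cos_le_one (t * Real.log p)]
  have hw0 : ∀ p ∈ primesUpTo (512 * v), 0 ≤ eulerWeight α p := fun p hp =>
    (eulerWeight_bounds hα (prime_of_mem_primesUpTo hp)).2.2.1
  have hGs : G ⊆ primesUpTo (512 * v) :=
    Finset.sdiff_subset.trans (primesUpTo_mono (by linarith))
  have hHs : H ⊆ primesUpTo (512 * v) := Finset.sdiff_subset
  have hGmem : ∀ p ∈ G, v < p ∧ (p : ℝ) ≤ 8 * v := by
    intro p hp
    rw [hG, Finset.mem_sdiff, mem_primesUpTo (by linarith), mem_primesUpTo (by linarith)] at hp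
    exact ⟨not_le.mp fun h => hp.2 ⟨h, hp.1.2⟩, hp.1.1⟩
  have hHmem : ∀ p ∈ H, 64 * v < p ∧ (p : ℝ) ≤ 512 * v := by
    intro p hp
    rw [hH, Finset.mem_sdiff, mem_primesUpTo (by linarith), mem_primesUpTo (by linarith)] at hp
    exact ⟨not_le.mp fun h => hp.2 ⟨h, hp.1.2⟩, hp.1.1⟩
  have hdisj : Disjoint G H := by
    rw [Finset.disjoint_left]
    intro p hp hp'
    have := (hGmem p hp).2
    have := (hHmem p hp').1
    linarith
  have hpair : ∀ p ∈ G, ∀ q ∈ H, t ^ 2 / 4 ≤ f p + f q := by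
    intro p hp q hq
    obtain ⟨a1, a2⟩ := hGmem p hp
    obtain ⟨b1, b2⟩ := hHmem q hq
    have e1 : t * Real.log q - t * Real.log p = t * Real.log (q / p) := by
      rw [Real.log_div (by linarith) (by linarith)]; ring
    have hp0 : (0 : ℝ) < p := by linarith
    have r1 : (8 : ℝ) ≤ q / p := by rw [le_div_iff₀ hp0]; linarith
    have r2 : (q / p : ℝ) ≤ 2 ^ 9 := by rw [div_le_iff₀ hp0]; norm_num; linarith
    have l1 : 1 ≤ Real.log (q / p) := by
      rw [Real.le_log_iff_exp_le (by linarith)]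
      linarith [Real.exp_one_lt_d9]
    have l2 : Real.log (q / p) ≤ 7 := by
      have := Real.log_le_log (by linarith) r2
      rw [Real.log_pow] at this
      have := Real.log_two_lt_d9
      push_cast at *; linarith
    have l3 : |t * Real.log (q / p)| ≤ 1 := by
      rw [abs_mul, abs_of_nonneg (by linarith : 0 ≤ Real.log (q / p))]
      nlinarith [abs_nonneg t]
    have c1 := Real.cos_le_one_sub_mul_cos_sq (x := t * Real.log (q / p))
      (l3.trans (by linarith [Real.pi_gt_three]))
    have c2 := sq_div_five_le_one_sub_cos l3
    have c3 := one_sub_cos_sub_le (t * Real.log q) (t * Real.log p)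
    rw [e1] at c3
    have l4 : 8 / 3 ≤ Real.log (q / p) ^ 2 := by
      have : 3 * Real.log 2 ≤ Real.log (q / p) := by
        have := Real.log_le_log (by norm_num) r1
        rw [show (8 : ℝ) = 2 ^ 3 by norm_num, Real.log_pow] at this
        exact_mod_cast this
      nlinarith [Real.log_two_gt_d9]
    rw [mul_pow] at c2
    simp only [hf]
    nlinarith [sq_nonneg t]
  set F := ∑ p ∈ primesUpTo (512 * v), (eulerWeight α p + eulerWeight α p ^ 2) * f p with hF
  set S1 := ∑ p ∈ G, eulerWeight α p
  set S2 := ∑ p ∈ H, eulerWeight α p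
  set F1 := ∑ p ∈ G, eulerWeight α p * f p
  set F2 := ∑ p ∈ H, eulerWeight α p * f p
  have hFs : F1 + F2 ≤ F := by
    have : F1 + F2 = ∑ p ∈ G ∪ H, eulerWeight α p * f p := (Finset.sum_union hdisj).symm
    rw [this]
    calc _ ≤ ∑ p ∈ primesUpTo (512 * v), eulerWeight α p * f p :=
          Finset.sum_le_sum_of_subset_of_nonneg (Finset.union_subset hGs hHs)
            fun p hp _ => mul_nonneg (hw0 p hp) (hf0 p)
      _ ≤ _ := Finset.sum_le_sum fun p _ => mul_le_mul_of_nonneg_right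
          (by nlinarith [sq_nonneg (eulerWeight α p)]) (hf0 p)
  have hprod : S1 * S2 * (t ^ 2 / 4) ≤ S2 * F1 + S1 * F2 := by
    have e1 : S1 * S2 * (t ^ 2 / 4) =
        ∑ p ∈ G, ∑ q ∈ H, eulerWeight α p * eulerWeight α q * (t ^ 2 / 4) := by
      simp only [S1, S2]
      rw [Finset.sum_mul_sum, Finset.sum_mul]
      exact Finset.sum_congr rfl fun p _ => Finset.sum_mul _ _ _
    have e2 : S2 * F1 + S1 * F2 =
        ∑ p ∈ G, ∑ q ∈ H, eulerWeight α p * eulerWeight α q * (f p + f q) := by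
      have a1 : S2 * F1 = ∑ p ∈ G, ∑ q ∈ H, eulerWeight α p * eulerWeight α q * f p := by
        rw [mul_comm, Finset.sum_mul_sum]
        exact Finset.sum_congr rfl fun p _ => Finset.sum_congr rfl fun q _ => by ring
      have a2 : S1 * F2 = ∑ p ∈ G, ∑ q ∈ H, eulerWeight α p * eulerWeight α q * f q := by
        rw [Finset.sum_mul_sum]
        exact Finset.sum_congr rfl fun p _ => Finset.sum_congr rfl fun q _ => by ring
      rw [a1, a2, ← Finset.sum_add_distrib]
      refine Finset.sum_congr rfl fun p _ => ?_
      rw [← Finset.sum_add_distrib]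
      exact Finset.sum_congr rfl fun q _ => by ring
    rw [e1, e2]
    exact Finset.sum_le_sum fun p hp => Finset.sum_le_sum fun q hq =>
      mul_le_mul_of_nonneg_left (hpair p hp q hq)
        (mul_nonneg (hw0 p (hGs hp)) (hw0 q (hHs hq)))
  have hF1 : 0 ≤ F1 := Finset.sum_nonneg fun p hp => mul_nonneg (hw0 p (hGs hp)) (hf0 p)
  have hF2 : 0 ≤ F2 := Finset.sum_nonneg fun p hp => mul_nonneg (hw0 p (hHs hp)) (hf0 p)
  rcases hS.eq_or_lt with h0 | h0
  · rw [← h0]; linarith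
  refine le_trans ?_ hFs
  by_contra! hlt
  have hF12 : F1 < S * t ^ 2 / 4 ∧ F2 < S * t ^ 2 / 4 := ⟨by linarith, by linarith⟩
  rcases le_total S1 S2 with h12 | h12
  · have : S2 * F1 + S1 * F2 ≤ S2 * (F1 + F2) := by nlinarith
    have : S2 * (F1 + F2) < S2 * (S * t ^ 2 / 4) := mul_lt_mul_of_pos_left hlt (by linarith)
    have : S2 * (S * (t ^ 2 / 4)) ≤ S2 * (S1 * (t ^ 2 / 4)) := by
      gcongr
      linarith
    linarith
  · have : S2 * F1 + S1 * F2 ≤ S1 * (F1 + F2) := by nlinarith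
    have : S1 * (F1 + F2) < S1 * (S * t ^ 2 / 4) := mul_lt_mul_of_pos_left hlt (by linarith)
    have : S1 * (S * (t ^ 2 / 4)) ≤ S1 * (S2 * (t ^ 2 / 4)) := by
      gcongr
      linarith
    linarith

theorem eventually_mul_one_add_log_pow_le_sqrt (C : ℝ) :
    ∀ᶠ x : ℝ in atTop, C * (1 + Real.log x) ^ 4 ≤ √x := by
  have h := ((isLittleO_log_rpow_atTop (r := 1 / 8) (by norm_num)).pow
    (by norm_num : 0 < 4)).bound (by positivity : 0 < 1 / (16 * (|C| + 1)))
  filter_upwards [h, eventually_ge_atTop (Real.exp 1)] with x hx hx1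
  have hx0 : 0 < x := (Real.exp_pos _).trans_le hx1
  have hl : 1 ≤ Real.log x := (Real.le_log_iff_exp_le hx0).mpr hx1
  rw [← Real.rpow_natCast (x ^ (1 / 8 : ℝ)), ← Real.rpow_mul hx0.le] at hx
  norm_num at hx
  rw [← one_div, ← Real.sqrt_eq_rpow, abs_of_nonneg (Real.sqrt_nonneg x),
    Even.pow_abs (by decide)] at hx
  have h1 : C * (1 + Real.log x) ^ 4 ≤ (|C| + 1) * (16 * Real.log x ^ 4) := by
    have : (1 + Real.log x) ^ 4 ≤ (2 * Real.log x) ^ 4 := by gcongr; linarith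
    calc _ ≤ (|C| + 1) * (1 + Real.log x) ^ 4 := by
          gcongr; linarith [le_abs_self C]
      _ ≤ (|C| + 1) * (2 * Real.log x) ^ 4 := by gcongr
      _ = _ := by ring
  refine h1.trans ?_
  have hC : 0 < |C| + 1 := by positivity
  calc (|C| + 1) * (16 * Real.log x ^ 4) ≤
        (|C| + 1) * (16 * (1 / (|C| + 1) * (1 / 16) * √x)) := by gcongr
    _ = √x := by field_simp

theorem pow_rpow_eq_sqrt {K : ℕ} (hK : K ≠ 0) {x : ℝ} (hx : 0 ≤ x) :
    (x ^ K) ^ (1 / (2 * K) : ℝ) = √x := by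
  rw [← Real.rpow_natCast, ← Real.rpow_mul hx, Real.sqrt_eq_rpow]
  congr 1
  have : (K : ℝ) ≠ 0 := by exact_mod_cast hK
  field_simp

/-- Existence of the saddle point. -/
theorem eventually_exists_logMean_eq {K : ℕ} (hK : 4 ≤ K) : ∀ᶠ x : ℝ in atTop,
    ∃ α : ℝ, 1 / 2 ≤ α ∧ α ≤ 1 - 1 / (2 * K) ∧ logMean (primesUpTo (x ^ K)) α = x := by
  have hpow : Tendsto (fun x : ℝ => x ^ K) atTop atTop := tendsto_pow_atTop (by omega)
  have hK0 : (4 : ℝ) ≤ K := by exact_mod_cast hK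
  have hκ : (1 : ℝ) / (2 * K) ≤ 1 / 2 := by
    rw [div_le_div_iff₀ (by positivity) (by norm_num)]; linarith
  filter_upwards [hpow.eventually eventually_half_le_theta, eventually_ge_atTop 2,
    eventually_mul_one_add_log_pow_le_sqrt (4 * K ^ 2)] with x h1 h2 h3
  have hlow : x ≤ logMean (primesUpTo (x ^ K)) (1 / 2) := by
    refine le_trans ?_ (le_logMean_half (by positivity) h1)
    have : x * 2 ≤ √(x ^ K) := by
      apply Real.le_sqrt_of_sq_le
      calc (x * 2) ^ 2 ≤ (x * x) ^ 2 := by gcongr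
        _ = x ^ 4 := by ring
        _ ≤ x ^ K := pow_le_pow_right₀ (by linarith) hK
    linarith
  have hl : 0 ≤ Real.log x := Real.log_nonneg (by linarith)
  have hup : logMean (primesUpTo (x ^ K)) (1 - 1 / (2 * K)) ≤ x := by
    refine (logMean_le (one_le_pow₀ (by linarith)) (by positivity) hκ).trans ?_
    rw [pow_rpow_eq_sqrt (by omega) (by linarith), Real.log_pow]
    have h4 : 4 * (K * Real.log x) * (1 + K * Real.log x) ≤ 4 * K ^ 2 * (1 + Real.log x) ^ 4 := by
      calc _ ≤ 4 * (K * (1 + Real.log x)) * (K * (1 + Real.log x)) := by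
            gcongr
            · linarith
            · nlinarith
        _ = 4 * K ^ 2 * (1 + Real.log x) ^ 2 := by ring
        _ ≤ _ := by gcongr <;> [linarith; norm_num]
    calc _ ≤ √x * √x := by gcongr; exact h4.trans h3
      _ = x := Real.mul_self_sqrt (by linarith)
  obtain ⟨α, hα1, hα2⟩ := intermediate_value_Icc' (by linarith : (1 / 2 : ℝ) ≤ 1 - 1 / (2 * K))
    (continuousOn_logMean (P := primesUpTo (x ^ K)) (fun p hp => prime_of_mem_primesUpTo hp)
      (1 / 2) (1 - 1 / (2 * K)) (by norm_num)) ⟨hup, hlow⟩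
  exact ⟨α, hα1.1, hα1.2, hα2⟩

theorem log_le_of_mem_primesUpTo {y : ℝ} (hy : 0 ≤ y) {p : ℕ} (hp : p ∈ primesUpTo y) :
    Real.log p ≤ Real.log y := by
  have h := (mem_primesUpTo hy).mp hp
  exact Real.log_le_log (by exact_mod_cast h.2.pos) h.1

theorem logVar_bounds {y α : ℝ} (hy : 0 ≤ y) (hα : 1 / 2 ≤ α) :
    logMean (primesUpTo y) α / 2 ≤ logVar (primesUpTo y) α ∧
      logVar (primesUpTo y) α ≤ 4 * Real.log y * logMean (primesUpTo y) α := by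
  rw [logVar, logMean, Finset.sum_div, Finset.mul_sum]
  constructor <;> apply Finset.sum_le_sum <;> intro p hp
  · have hp' := prime_of_mem_primesUpTo hp
    obtain ⟨_, _, h0, h3⟩ := eulerWeight_bounds hα hp'
    have hl : 1 / 2 ≤ Real.log p := by
      have := Real.log_le_log (by norm_num) (by exact_mod_cast hp'.two_le : (2 : ℝ) ≤ p)
      linarith [Real.log_two_gt_d9]
    calc _ = eulerWeight α p * (Real.log p * (1 / 2)) := by ring
      _ ≤ (eulerWeight α p + eulerWeight α p ^ 2) * (Real.log p * Real.log p) := by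
        gcongr; nlinarith
      _ = _ := by ring
  · have hp' := prime_of_mem_primesUpTo hp
    obtain ⟨_, _, h0, h3⟩ := eulerWeight_bounds hα hp'
    have hl := Real.log_natCast_nonneg p
    have hl2 := log_le_of_mem_primesUpTo hy hp
    calc _ = (eulerWeight α p + eulerWeight α p ^ 2) * Real.log p * Real.log p := by ring
      _ ≤ (4 * eulerWeight α p) * Real.log p * Real.log y := by
        gcongr
        nlinarith
      _ = _ := by ring

theorem sum_eulerWeight_sdiff_ge {y u κ α w : ℝ} (hy : 1 < y) (hu : u ≤ y) (hα : 1 / 2 ≤ α)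
    (hακ : α ≤ 1 - κ)
    {v : ℝ} (h : w ≤ ∑ p ∈ primesUpTo u \ primesUpTo v, Real.log p) :
    w * (y ^ κ / y / Real.log y) ≤ ∑ p ∈ primesUpTo u \ primesUpTo v, eulerWeight α p := by
  have hl := Real.log_pos hy
  have hy0 : 0 < y := by linarith
  refine (mul_le_mul_of_nonneg_right h (by positivity)).trans ?_
  rw [Finset.sum_mul]
  apply Finset.sum_le_sum
  intro p hp
  have hpy : p ∈ primesUpTo y := primesUpTo_mono hu (Finset.mem_sdiff.mp hp).1
  have hp' := (mem_primesUpTo hy0.le).mp hpy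
  refine le_trans ?_ (eulerWeight_bounds hα hp'.2).1
  have h1 : (1 : ℝ) ≤ p := by exact_mod_cast hp'.2.one_le
  calc Real.log p * (y ^ κ / y / Real.log y) ≤ Real.log y * (y ^ κ / y / Real.log y) := by
        gcongr
        exact hp'.1
    _ = y ^ κ / y := by field_simp
    _ = y ^ (-(1 - κ)) := by rw [neg_sub, Real.rpow_sub hy0, Real.rpow_one]
    _ ≤ (p : ℝ) ^ (-(1 - κ)) := by
        apply Real.rpow_le_rpow_of_nonpos (by linarith) hp'.1
        linarith
    _ ≤ (p : ℝ) ^ (-α) := Real.rpow_le_rpow_of_exponent_le h1 (by linarith)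

/-- An integrable majorant for the rescaled characteristic function. -/
noncomputable def charMajorant (s : ℝ) : ℝ := Real.exp (-(1 / 245) * s ^ 2) + (1 + s ^ 2)⁻¹

theorem charMajorant_nonneg (s : ℝ) : 0 ≤ charMajorant s := by
  unfold charMajorant; positivity

theorem integrable_charMajorant : MeasureTheory.Integrable charMajorant :=
  (integrable_exp_neg_mul_sq (by norm_num)).add integrable_inv_one_add_sq

theorem eventually_norm_inv_invChar_le {K : ℕ} (hK : 4 ≤ K) : ∀ᶠ x : ℝ in atTop,
    ∀ α σ : ℝ, 1 / 2 ≤ α → α ≤ 1 - 1 / (2 * K) → logMean (primesUpTo (x ^ K)) α = x →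
      σ ^ 2 = logVar (primesUpTo (x ^ K)) α → ∀ t, |t| ≤ 1 / 7 →
        ‖(invChar (primesUpTo (x ^ K)) α t)⁻¹‖ ≤ charMajorant (σ * t) := by
  have hpow : Tendsto (fun x : ℝ => x ^ K) atTop atTop := tendsto_pow_atTop (by omega)
  have hK0 : (4 : ℝ) ≤ K := by exact_mod_cast hK
  have h512 : Tendsto (fun x : ℝ => x ^ K / 512) atTop atTop :=
    hpow.atTop_div_const (by norm_num)
  have h8 : Tendsto (fun x : ℝ => x ^ K / 8) atTop atTop := hpow.atTop_div_const (by norm_num)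
  filter_upwards [h512.eventually eventually_le_sum_log_sdiff,
    h8.eventually eventually_le_sum_log_sdiff, eventually_ge_atTop (4 * K : ℝ),
    eventually_mul_one_add_log_pow_le_sqrt (3 * 100352 * K ^ 3)] with x h1 h2 h3 h4
  intro α σ hα1 hα2 hmean hσ t ht
  set y := x ^ K with hy
  have hx4 : 4 ≤ x := by nlinarith
  have hy1 : 4 ≤ y := hx4.trans (le_self_pow₀ (by linarith) (by omega))
  set ℓ := Real.log y with hℓ
  have hℓK : ℓ = K * Real.log x := by rw [hℓ, hy, Real.log_pow]
  have hlx : 0 < Real.log x := Real.log_pos (by linarith)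
  have hℓ0 : 0 < ℓ := Real.log_pos (by linarith)
  have hb : ∀ p ∈ primesUpTo y, 0 ≤ eulerWeight α p ∧ eulerWeight α p ≤ 3 := fun p hp =>
    (eulerWeight_bounds hα1 (prime_of_mem_primesUpTo hp)).2.2
  rcases le_total (|t| * ℓ) 1 with hc | hc
  · refine (norm_inv_invChar_le_of_small hb
      (fun p hp => log_le_of_mem_primesUpTo (by linarith) hp) hc).trans ?_
    rw [← hσ, charMajorant]
    have : 0 ≤ (1 + (σ * t) ^ 2)⁻¹ := by positivity
    have e : -(σ ^ 2 * t ^ 2 / 245) = -(1 / 245) * (σ * t) ^ 2 := by ring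
    rw [e]; linarith
  · have hv := (logVar_bounds (y := y) (by linarith) hα1).2
    rw [← hσ, hmean] at hv
    have e512 : 512 * (y / 512) = y := by ring
    have e64 : 64 * (y / 512) = y / 8 := by ring
    have e8 : 8 * (y / 8) = y := by ring
    rw [e8] at h2
    have g1 := sum_eulerWeight_sdiff_ge (y := y) (by linarith) (by linarith) hα1 hα2 h1
    have g2 := sum_eulerWeight_sdiff_ge (y := y) (by linarith) le_rfl hα1 hα2
      ((by linarith : y / 512 ≤ y / 8).trans h2)
    have hk := pow_rpow_eq_sqrt (K := K) (by omega) (by linarith : 0 ≤ x)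
    rw [← hy] at hk
    rw [hk, ← hℓ] at g1 g2
    have eS : y / 512 * (√x / y / ℓ) = √x / (512 * ℓ) := by field_simp
    rw [eS] at g1 g2
    have key := sum_mul_one_sub_cos_ge (v := y / 512) (α := α) (t := t) (by linarith)
      (by positivity) ht hα1 g1 (by rw [e512, e64]; exact g2)
    rw [e512] at key
    refine (norm_inv_invChar_le hb t).trans ?_
    have hexp : 3 * Real.log x ≤ 1 / 49 * (√x / (512 * ℓ) * t ^ 2 / 4) := by
      have ht2 : 1 / ℓ ^ 2 ≤ t ^ 2 := by
        rw [div_le_iff₀ (by positivity), ← sq_abs t, ← mul_pow]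
        exact one_le_pow₀ hc
      calc 3 * Real.log x = 3 * 100352 * K ^ 3 * Real.log x ^ 4 / (100352 * ℓ ^ 3) := by
            rw [hℓK]; field_simp
        _ ≤ √x / (100352 * ℓ ^ 3) := by
            gcongr
            refine le_trans ?_ h4
            gcongr; linarith
        _ = 1 / 49 * (√x / (512 * ℓ) * (1 / ℓ ^ 2) / 4) := by field_simp; norm_num
        _ ≤ _ := by gcongr
    have hσt : 1 + (σ * t) ^ 2 ≤ x ^ 3 := by
      have ht2 : t ^ 2 ≤ 1 / 49 := by rw [← sq_abs]; nlinarith [abs_nonneg t]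
      have : ℓ ≤ x * x := by
        rw [hℓK]
        have := Real.log_le_self (by linarith : 0 ≤ x)
        nlinarith
      have h5 : σ ^ 2 * t ^ 2 ≤ (4 * (x * x) * x) * (1 / 49) := by
        refine mul_le_mul (hv.trans ?_) ht2 (sq_nonneg t) (by positivity)
        gcongr
      nlinarith [pow_le_pow_left₀ (by norm_num) hx4 3]
    calc _ ≤ Real.exp (-(3 * Real.log x)) := by
          rw [Real.exp_le_exp, neg_le_neg_iff]
          refine hexp.trans ?_
          gcongr
      _ = (x ^ 3)⁻¹ := by
          rw [Real.exp_neg, show 3 * Real.log x = Real.log (x ^ 3) by rw [Real.log_pow]; norm_num,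
            Real.exp_log (by positivity)]
      _ ≤ (1 + (σ * t) ^ 2)⁻¹ := inv_anti₀ (by positivity) hσt
      _ ≤ _ := by rw [charMajorant]; linarith [Real.exp_pos (-(1 / 245) * (σ * t) ^ 2)]

/-- The normalised smooth weights have, at scale `1`, asymptotically constant density just below
`N`, and bounded density everywhere. -/
theorem exists_smoothMass_asymptotics {K : ℕ} (hK : 4 ≤ K) : ∃ (α σ : ℕ → ℝ) (C c : ℝ), 0 < c ∧
    (∀ᶠ N in atTop, 1 / 2 ≤ α N ∧ α N ≤ 1 - 1 / (2 * K) ∧ 0 < σ N) ∧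
    (∀ᶠ N in atTop, ∀ x, σ N * smoothMass (primesUpTo (Real.log N ^ K)) (α N) (1 / 7) x ≤ C) ∧
    ∀ h, Tendsto (fun N : ℕ => σ N * smoothMass (primesUpTo (Real.log N ^ K)) (α N) (1 / 7)
      (Real.log N - h)) atTop (𝓝 c) := by
  have hlog : Tendsto (fun N : ℕ => Real.log N) atTop atTop :=
    Real.tendsto_log_atTop.comp tendsto_natCast_atTop_atTop
  obtain ⟨α, hα⟩ := (hlog.eventually (eventually_exists_logMean_eq hK)).choice
  set P : ℕ → Finset ℕ := fun N => primesUpTo (Real.log N ^ K) with hPdef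
  have hP : ∀ N, ∀ p ∈ P N, p.Prime := fun N p hp => prime_of_mem_primesUpTo hp
  set σ : ℕ → ℝ := fun N => √(logVar (P N) (α N)) with hσdef
  have hσ2 : ∀ᶠ N : ℕ in atTop, σ N ^ 2 = logVar (P N) (α N) ∧ √(Real.log N / 2) ≤ σ N := by
    filter_upwards [hα, hlog.eventually_ge_atTop 1] with N h1 h2
    have := (logVar_bounds (y := Real.log N ^ K) (by positivity) h1.1).1
    rw [h1.2.2] at this
    exact ⟨Real.sq_sqrt (by simp only [P]; linarith), Real.sqrt_le_sqrt this⟩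
  have hsq : Tendsto (fun N : ℕ => √(Real.log N / 2)) atTop atTop :=
    Real.tendsto_sqrt_atTop.comp (hlog.atTop_div_const (by norm_num))
  have hσt : Tendsto σ atTop atTop := tendsto_atTop_mono' _ (hσ2.mono fun N h => h.2) hsq
  have hmaj : ∀ᶠ N in atTop, ∀ t, |t| ≤ 1 / 7 →
      ‖(invChar (P N) (α N) t)⁻¹‖ ≤ charMajorant (σ N * t) := by
    filter_upwards [hα, hσ2, hlog.eventually (eventually_norm_inv_invChar_le hK)] with N h1 h2 h3
    exact h3 (α N) (σ N) h1.1 h1.2.1 h1.2.2 h2.1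
  have hα0 : ∀ᶠ N in atTop, 0 < α N := hα.mono fun N h => by linarith [h.1]
  refine ⟨α, σ, (∫ s, charMajorant s) / (1 / 7), √(Real.pi / (1 / 2)) / (1 / 7), by positivity,
    ?_, ?_, ?_⟩
  · filter_upwards [hα, hσt.eventually_gt_atTop 0] with N h1 h2
    exact ⟨h1.1, h1.2.1, h2⟩
  · filter_upwards [hα0, hσt.eventually_gt_atTop 0, hmaj] with N h1 h2 h3 x
    exact smoothMass_le (hP N) h1 (by norm_num) h2 x charMajorant_nonneg integrable_charMajorant h3
  · intro h
    apply tendsto_smoothMass hP hα0 (by norm_num) hσt charMajorant_nonneg integrable_charMajorant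
      hmaj
    intro s
    have hlim := tendsto_exp_mul_inv_invChar (P := P) (α := α) (σ := σ)
      (ℓ := fun N => Real.log (Real.log N ^ K))
      (by
        filter_upwards [hα] with N h1 p hp
        exact (eulerWeight_bounds h1.1 (hP N p hp)).2.2)
      (by
        filter_upwards [hlog.eventually_ge_atTop 1] with N h1 p hp
        exact log_le_of_mem_primesUpTo (by positivity) hp)
      (by
        filter_upwards [hσ2, hσt.eventually_gt_atTop 0] with N h1 h2
        exact ⟨h2, h1.1⟩)
      (by
        have h0 : Tendsto (fun x : ℝ => (2 * K) * (Real.log x / x ^ (1 / 2 : ℝ))) atTop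
            (𝓝 ((2 * K) * 0)) :=
          ((isLittleO_log_rpow_atTop (by norm_num : (0 : ℝ) < 1 / 2)).tendsto_div_nhds_zero).const_mul _
        rw [mul_zero] at h0
        refine squeeze_zero' ?_ ?_ (h0.comp hlog)
        · filter_upwards [hlog.eventually_ge_atTop 1] with N h1
          have : 0 ≤ Real.log (Real.log N ^ K) := Real.log_nonneg (one_le_pow₀ h1)
          positivity
        · filter_upwards [hlog.eventually_ge_atTop 1, hσ2] with N h1 h2
          have h3 : 0 ≤ Real.log (Real.log N) := Real.log_nonneg h1
          have h4 : √(Real.log N) / 2 ≤ σ N := by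
            refine le_trans ?_ h2.2
            rw [Real.sqrt_div (by linarith)]
            apply div_le_div_of_nonneg_left (Real.sqrt_nonneg _) (by positivity)
            rw [Real.sqrt_le_iff]; norm_num
          have h5 : 0 < √(Real.log N) := Real.sqrt_pos.mpr (by linarith)
          simp only [Function.comp]
          rw [Real.log_pow, ← Real.sqrt_eq_rpow]
          calc _ ≤ K * Real.log (Real.log N) / (√(Real.log N) / 2) := by gcongr
            _ = _ := by field_simp) s
    refine hlim.congr' ?_
    filter_upwards [hα] with N h1
    rw [h1.2.2]

/-- An arithmetic progression of integers, most pairs of which are coprime. -/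
def dilate (W L l : ℕ) : ℕ := 1 + W * (L + l)

theorem dilate_pos (W L l : ℕ) : 0 < dilate W L l := by unfold dilate; omega

theorem coprime_dilate (W L l : ℕ) : Nat.Coprime (dilate W L l) W := by
  unfold dilate
  rw [Nat.coprime_add_mul_left_left]
  exact Nat.coprime_one_left W

theorem dvd_sub_of_dvd_dilate {W L l l' g : ℕ} (h : g ∣ dilate W L l) (h' : g ∣ dilate W L l') :
    g ∣ l - l' := by
  rcases le_total l l' with hl | hl
  · simp [Nat.sub_eq_zero_of_le hl]
  have h1 : g ∣ dilate W L l - dilate W L l' := Nat.dvd_sub h h'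
  have h2 : dilate W L l - dilate W L l' = W * (l - l') := by
    unfold dilate
    rw [Nat.add_sub_add_left, ← Nat.mul_sub, Nat.add_sub_add_left]
  rw [h2] at h1
  exact (Nat.Coprime.coprime_dvd_left h (coprime_dilate W L l)).dvd_of_dvd_mul_left h1

theorem card_filter_dvd_dilate_le {W L g : ℕ} (hg : 0 < g) :
    ((Finset.range L).filter fun l => g ∣ dilate W L l).card ≤ L / g + 1 := by
  rw [← Finset.card_range (L / g + 1)]
  apply Finset.card_le_card_of_injOn (fun l => l / g)
  · intro l hl
    have := (Finset.mem_filter.mp hl).1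
    rw [Finset.mem_range] at this
    simp only [Finset.coe_range, Set.mem_Iio]
    exact Nat.lt_succ_of_le (Nat.div_le_div_right this.le)
  · have key : ∀ l l' : ℕ, g ∣ dilate W L l → g ∣ dilate W L l' → l / g = l' / g → l ≤ l' := by
      intro l l' h h' e
      have h1 := dvd_sub_of_dvd_dilate h h'
      have h2 : l - l' < g := by
        have := Nat.div_add_mod l g
        have := Nat.div_add_mod l' g
        have := Nat.mod_lt l hg
        rw [e] at *
        omega
      have := Nat.eq_zero_of_dvd_of_lt h1 h2
      omega
    intro l hl l' hl' e
    have h1 := (Finset.mem_filter.mp hl).2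
    have h2 := (Finset.mem_filter.mp hl').2
    exact le_antisymm (key _ _ h1 h2 e) (key _ _ h2 h1 e.symm)

theorem lt_of_dvd_dilate_factorial {w L l g : ℕ} (h : g ∣ dilate w.factorial L l) (hg : g ≠ 1) :
    w < g := by
  by_contra! hle
  have hg0 : 0 < g := Nat.pos_of_dvd_of_pos h (dilate_pos _ _ _)
  have h1 := Nat.Coprime.coprime_dvd_left h (coprime_dilate w.factorial L l)
  exact hg (Nat.Coprime.eq_one_of_dvd h1 (Nat.dvd_factorial hg0 hle))

theorem gcd_dilate_rpow_le {w L l l' : ℕ} (hl : l < L) (hl' : l' < L) (r : ℝ) :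
    (Nat.gcd (dilate w.factorial L l) (dilate w.factorial L l') : ℝ) ^ r ≤
      1 + (if l = l' then (dilate w.factorial L l : ℝ) ^ r else 0) +
      ∑ g ∈ Finset.Ioo w L, if g ∣ dilate w.factorial L l ∧ g ∣ dilate w.factorial L l' then
        (g : ℝ) ^ r else 0 := by
  have hsum : ∀ g ∈ Finset.Ioo w L, (0 : ℝ) ≤
      if g ∣ dilate w.factorial L l ∧ g ∣ dilate w.factorial L l' then (g : ℝ) ^ r else 0 := by
    intro g _
    split_ifs <;> positivity
  have hS := Finset.sum_nonneg hsum
  rcases eq_or_ne l l' with rfl | hne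
  · rw [if_pos rfl, Nat.gcd_self]
    linarith
  rw [if_neg hne]
  set g := Nat.gcd (dilate w.factorial L l) (dilate w.factorial L l') with hg
  have h1 : g ∣ dilate w.factorial L l := Nat.gcd_dvd_left _ _
  have h2 : g ∣ dilate w.factorial L l' := Nat.gcd_dvd_right _ _
  by_cases hg1 : g = 1
  · rw [hg1]; simp only [Nat.cast_one, Real.one_rpow]; linarith
  have hgL : g < L := by
    rcases lt_or_gt_of_ne hne with h | h
    · have := Nat.le_of_dvd (by omega) (dvd_sub_of_dvd_dilate h2 h1)
      omega
    · have := Nat.le_of_dvd (by omega) (dvd_sub_of_dvd_dilate h1 h2)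
      omega
  have := Finset.single_le_sum hsum
    (Finset.mem_Ioo.mpr ⟨lt_of_dvd_dilate_factorial h1 hg1, hgL⟩)
  rw [if_pos ⟨h1, h2⟩] at this
  linarith

theorem sum_gcd_dilate_rpow_le {w L : ℕ} {κ : ℝ} (hκ0 : 0 < κ) (hκ1 : κ ≤ 1) :
    ∑ l ∈ Finset.range L, ∑ l' ∈ Finset.range L,
      (Nat.gcd (dilate w.factorial L l) (dilate w.factorial L l') : ℝ) ^ (1 - κ) ≤
    (L : ℝ) ^ 2 * (1 + 3 * w.factorial * (L : ℝ) ^ (-κ) +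
      4 * ∑ g ∈ Finset.Ioo w L, (g : ℝ) ^ (-(1 + κ))) := by
  rcases Nat.eq_zero_or_pos L with rfl | hL
  · simp
  have hL0 : (0 : ℝ) < L := by exact_mod_cast hL
  refine (Finset.sum_le_sum fun l hl => Finset.sum_le_sum fun l' hl' =>
    gcd_dilate_rpow_le (Finset.mem_range.mp hl) (Finset.mem_range.mp hl') (1 - κ)).trans ?_
  simp only [Finset.sum_add_distrib]
  rw [mul_add, mul_add]
  refine add_le_add (add_le_add ?_ ?_) ?_
  · simp; ring_nf; rfl
  · have h1 : ∀ l ∈ Finset.range L, (∑ l' ∈ Finset.range L,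
        if l = l' then (dilate w.factorial L l : ℝ) ^ (1 - κ) else 0) ≤
        3 * w.factorial * (L * (L : ℝ) ^ (-κ)) := by
      intro l hl
      rw [Finset.sum_ite_eq, if_pos hl]
      have hw : (1 : ℝ) ≤ w.factorial := by exact_mod_cast Nat.factorial_pos w
      have hd : (dilate w.factorial L l : ℝ) ≤ 3 * w.factorial * L := by
        have : (l : ℝ) ≤ L := by exact_mod_cast (Finset.mem_range.mp hl).le
        have hL1 : (1 : ℝ) ≤ L := by exact_mod_cast hL
        unfold dilate
        push_cast
        nlinarith
      calc (dilate w.factorial L l : ℝ) ^ (1 - κ) ≤ (3 * w.factorial * L : ℝ) ^ (1 - κ) :=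
            Real.rpow_le_rpow (by positivity) hd (by linarith)
        _ = (3 * w.factorial : ℝ) ^ (1 - κ) * (L : ℝ) ^ (1 - κ) :=
            Real.mul_rpow (by positivity) (by positivity)
        _ ≤ (3 * w.factorial : ℝ) ^ (1 : ℝ) * (L : ℝ) ^ (1 - κ) := by
            gcongr
            · linarith
            · linarith
        _ = _ := by
            rw [Real.rpow_one, sub_eq_add_neg, Real.rpow_add hL0, Real.rpow_one]
    refine (Finset.sum_le_sum h1).trans (le_of_eq ?_)
    rw [Finset.sum_const, Finset.card_range, nsmul_eq_mul]
    ring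
  · have e : ∀ l ∈ Finset.range L, (∑ l' ∈ Finset.range L, ∑ g ∈ Finset.Ioo w L,
        if g ∣ dilate w.factorial L l ∧ g ∣ dilate w.factorial L l' then (g : ℝ) ^ (1 - κ) else 0) =
        ∑ g ∈ Finset.Ioo w L, ∑ l' ∈ Finset.range L,
        if g ∣ dilate w.factorial L l ∧ g ∣ dilate w.factorial L l' then (g : ℝ) ^ (1 - κ) else 0 :=
      fun l _ => Finset.sum_comm
    rw [Finset.sum_congr rfl e, Finset.sum_comm, Finset.mul_sum, Finset.mul_sum]
    apply Finset.sum_le_sum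
    intro g hg
    obtain ⟨hg1, hg2⟩ := Finset.mem_Ioo.mp hg
    have hg0 : 0 < g := by omega
    have hgr : (0 : ℝ) < g := by exact_mod_cast hg0
    have hcard := card_filter_dvd_dilate_le (W := w.factorial) (L := L) hg0
    set c := ((Finset.range L).filter fun l => g ∣ dilate w.factorial L l).card with hc
    have hsum : (∑ l ∈ Finset.range L, ∑ l' ∈ Finset.range L,
        if g ∣ dilate w.factorial L l ∧ g ∣ dilate w.factorial L l' then (g : ℝ) ^ (1 - κ) else 0) =
        (c : ℝ) ^ 2 * (g : ℝ) ^ (1 - κ) := by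
      simp only [ite_and]
      have : ∀ l, (∑ l' ∈ Finset.range L, if g ∣ dilate w.factorial L l then
          if g ∣ dilate w.factorial L l' then (g : ℝ) ^ (1 - κ) else 0 else 0) =
          if g ∣ dilate w.factorial L l then c * (g : ℝ) ^ (1 - κ) else 0 := by
        intro l
        split_ifs
        · rw [← Finset.sum_filter, Finset.sum_const, nsmul_eq_mul]
        · simp
      simp only [this]
      rw [← Finset.sum_filter, Finset.sum_const, nsmul_eq_mul]
      ring
    rw [hsum]
    have hc2 : (c : ℝ) ≤ 2 * L / g := by
      have h1 : (c : ℝ) ≤ (L / g : ℕ) + 1 := by exact_mod_cast hcard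
      have h2 : ((L / g : ℕ) : ℝ) ≤ L / g := Nat.cast_div_le
      have h3 : (1 : ℝ) ≤ L / g := by
        rw [le_div_iff₀ hgr, one_mul]; exact_mod_cast hg2.le
      calc (c : ℝ) ≤ L / g + L / g := by linarith
        _ = _ := by ring
    calc _ ≤ (2 * L / g : ℝ) ^ 2 * (g : ℝ) ^ (1 - κ) := by gcongr
      _ = (L : ℝ) ^ 2 * (4 * ((g : ℝ) ^ (1 - κ) / (g : ℝ) ^ (2 : ℝ))) := by
          rw [Real.rpow_two]; field_simp; ring
      _ = _ := by
          rw [← Real.rpow_sub hgr]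
          congr 3
          ring_nf

theorem exists_sum_gcd_dilate_le {κ ε : ℝ} (hκ0 : 0 < κ) (hκ1 : κ ≤ 1) (hε : 0 < ε) :
    ∃ W : ℕ, 0 < W ∧ ∀ᶠ L : ℕ in atTop, ∑ l ∈ Finset.range L, ∑ l' ∈ Finset.range L,
      (Nat.gcd (dilate W L l) (dilate W L l') : ℝ) ^ (1 - κ) ≤ (L : ℝ) ^ 2 * (1 + ε) := by
  have hsum : Summable fun g : ℕ => (g : ℝ) ^ (-(1 + κ)) :=
    Real.summable_nat_rpow.mpr (by linarith)
  obtain ⟨s, hs⟩ := summable_iff_vanishing_norm.mp hsum (ε / 8) (by positivity)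
  set w := s.sup id with hw
  refine ⟨w.factorial, w.factorial_pos, ?_⟩
  have h1 : Tendsto (fun L : ℕ => 3 * w.factorial * (L : ℝ) ^ (-κ)) atTop
      (𝓝 (3 * w.factorial * 0)) :=
    ((tendsto_rpow_neg_atTop hκ0).comp tendsto_natCast_atTop_atTop).const_mul _
  rw [mul_zero] at h1
  filter_upwards [h1.eventually_lt_const (half_pos hε)] with L hL
  refine (sum_gcd_dilate_rpow_le hκ0 hκ1).trans ?_
  have h2 := hs (Finset.Ioo w L) (by
    rw [Finset.disjoint_left]
    intro g hg hgs
    have := Finset.le_sup (f := id) hgs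
    rw [← hw] at this
    exact absurd (Finset.mem_Ioo.mp hg).1 (not_lt.mpr this))
  have h3 := (le_abs_self _).trans_lt h2
  exact mul_le_mul_of_nonneg_left (by linarith) (by positivity)

/-- The mass that a weight function on the natural numbers puts near `exp x`. -/
noncomputable def kernelMass (ω : ℕ → ℝ) (x : ℝ) : ℝ :=
  ∑' n : ℕ, ω n * fejer (1 / 7) (x - Real.log n)

/-- A weight function proportional to `n ^ (-α)` on a set of positive integers closed under
multiplication and division, whose mass at logarithmic scale `1` is bounded by `C`. -/
structure IsScaledDensity (F : Set ℕ) (α lam C : ℝ) (ω : ℕ → ℝ) : Prop where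
  pos_of_mem : ∀ n ∈ F, 0 < n
  mul_mem_iff : ∀ d m, d * m ∈ F ↔ d ∈ F ∧ m ∈ F
  lam_pos : 0 < lam
  half_le : 1 / 2 ≤ α
  le_one : α ≤ 1
  apply_of_mem : ∀ n ∈ F, ω n = lam * (n : ℝ) ^ (-α)
  apply_of_notMem : ∀ n, n ∉ F → ω n = 0
  summable : Summable ω
  mass_le : ∀ x, kernelMass ω x ≤ C

namespace IsScaledDensity

variable {F : Set ℕ} {α lam C : ℝ} {ω : ℕ → ℝ}

theorem nonneg (h : IsScaledDensity F α lam C ω) (n : ℕ) : 0 ≤ ω n := by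
  by_cases hn : n ∈ F
  · rw [h.apply_of_mem n hn]
    have := h.lam_pos
    positivity
  · rw [h.apply_of_notMem n hn]

theorem summable_mul_fejer (h : IsScaledDensity F α lam C ω) (x : ℝ) :
    Summable fun n : ℕ => ω n * fejer (1 / 7) (x - Real.log n) :=
  h.summable.of_nonneg_of_le (fun n => mul_nonneg (h.nonneg n) (fejer_nonneg _ _))
    fun n => mul_le_of_le_one_right (h.nonneg n) (fejer_le_one _ _)

theorem kernelMass_nonneg (h : IsScaledDensity F α lam C ω) (x : ℝ) : 0 ≤ kernelMass ω x :=
  tsum_nonneg fun n => mul_nonneg (h.nonneg n) (fejer_nonneg _ _)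

theorem bound_nonneg (h : IsScaledDensity F α lam C ω) : 0 ≤ C :=
  (h.kernelMass_nonneg 0).trans (h.mass_le 0)

theorem sum_mul_fejer_le (h : IsScaledDensity F α lam C ω) (A : Finset ℕ) (x : ℝ) :
    ∑ n ∈ A, ω n * fejer (1 / 7) (x - Real.log n) ≤ C :=
  ((h.summable_mul_fejer x).sum_le_tsum A
    fun n _ => mul_nonneg (h.nonneg n) (fejer_nonneg _ _)).trans (h.mass_le x)

theorem sum_window_le (h : IsScaledDensity F α lam C ω) {A : Finset ℕ} {x : ℝ}
    (hA : ∀ n ∈ A, |x - Real.log n| ≤ 1) : ∑ n ∈ A, ω n ≤ 3 * C := by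
  have h1 := h.sum_mul_fejer_le A x
  have h2 : ∑ n ∈ A, ω n * (1 / 3) ≤ ∑ n ∈ A, ω n * fejer (1 / 7) (x - Real.log n) := by
    apply Finset.sum_le_sum
    intro n hn
    apply mul_le_mul_of_nonneg_left _ (h.nonneg n)
    apply one_third_le_fejer
    rw [abs_mul, abs_of_pos (by norm_num)]
    linarith [hA n hn]
  rw [← Finset.sum_mul] at h2
  linarith

/-- The floor of the distance from `x` to `log n`. -/
noncomputable def logFloor (x : ℝ) (n : ℕ) : ℕ := ⌊x - Real.log n⌋₊

theorem abs_sub_logFloor_le {x : ℝ} {n : ℕ} (hn : Real.log n ≤ x) :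
    |x - logFloor x n - Real.log n| ≤ 1 := by
  have h1 := Nat.floor_le (by linarith : 0 ≤ x - Real.log n)
  have h2 := Nat.lt_floor_add_one (x - Real.log n)
  unfold logFloor
  rw [abs_le]; constructor <;> linarith

/-- A window of length `I` carries mass at most `3 (I + 1) C`. -/
theorem sum_interval_le (h : IsScaledDensity F α lam C ω) {A : Finset ℕ} {x : ℝ} {I : ℕ}
    (hA : ∀ n ∈ A, Real.log n ≤ x ∧ x - I ≤ Real.log n) : ∑ n ∈ A, ω n ≤ 3 * (I + 1) * C := by
  have hmaps : ∀ n ∈ A, logFloor x n ∈ Finset.range (I + 1) := by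
    intro n hn
    rw [Finset.mem_range, Nat.lt_succ_iff]
    apply Nat.floor_le_of_le
    linarith [(hA n hn).2]
  rw [← Finset.sum_fiberwise_of_maps_to hmaps]
  calc _ ≤ ∑ i ∈ Finset.range (I + 1), 3 * C := by
        apply Finset.sum_le_sum
        intro i _
        apply h.sum_window_le (x := x - i)
        intro n hn
        obtain ⟨h1, h2⟩ := Finset.mem_filter.mp hn
        rw [← h2]
        exact abs_sub_logFloor_le (hA n h1).1
    _ = _ := by simp; ring

/-- Counting bound. -/
theorem card_le (h : IsScaledDensity F α lam C ω) {A : Finset ℕ} {x : ℝ}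
    (hAF : ∀ n ∈ A, n ∈ F) (hA : ∀ n ∈ A, Real.log n ≤ x) :
    lam * A.card ≤ 9 * C * Real.exp (α * x) := by
  have hC := h.bound_nonneg
  have hα := h.half_le
  obtain ⟨M, hM⟩ : ∃ M, ∀ n ∈ A, logFloor x n < M :=
    ⟨(A.sup (logFloor x)) + 1, fun n hn => Nat.lt_succ_of_le (Finset.le_sup hn)⟩
  have hmaps : ∀ n ∈ A, logFloor x n ∈ Finset.range M := fun n hn => Finset.mem_range.mpr (hM n hn)
  have h1 : ∀ n ∈ A, lam ≤ Real.exp (α * x) * (Real.exp (-(1 / 2)) ^ logFloor x n * ω n) := by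
    intro n hn
    have hn0 : (0 : ℝ) < n := by exact_mod_cast h.pos_of_mem n (hAF n hn)
    rw [h.apply_of_mem n (hAF n hn), Real.rpow_def_of_pos hn0, ← Real.exp_nat_mul]
    have h2 := Nat.floor_le (by linarith [hA n hn] : 0 ≤ x - Real.log n)
    have h3 : 1 ≤ Real.exp (α * x + (logFloor x n * -(1 / 2) + Real.log n * -α)) := by
      rw [Real.one_le_exp_iff]
      have h4 : (logFloor x n : ℝ) * (1 / 2) ≤ (x - Real.log n) * α :=
        mul_le_mul h2 hα (by norm_num) (by linarith [hA n hn])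
      nlinarith
    rw [Real.exp_add, Real.exp_add] at h3
    nlinarith [h.lam_pos]
  have h2 : ∑ n ∈ A, Real.exp (-(1 / 2)) ^ logFloor x n * ω n ≤ 9 * C := by
    rw [← Finset.sum_fiberwise_of_maps_to hmaps]
    have h3 : ∀ i ∈ Finset.range M, (∑ n ∈ A with logFloor x n = i,
        Real.exp (-(1 / 2)) ^ logFloor x n * ω n) ≤ Real.exp (-(1 / 2)) ^ i * (3 * C) := by
      intro i _
      have : (∑ n ∈ A with logFloor x n = i, Real.exp (-(1 / 2)) ^ logFloor x n * ω n) =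
          Real.exp (-(1 / 2)) ^ i * ∑ n ∈ A with logFloor x n = i, ω n := by
        rw [Finset.mul_sum]
        apply Finset.sum_congr rfl
        intro n hn
        rw [(Finset.mem_filter.mp hn).2]
      rw [this]
      apply mul_le_mul_of_nonneg_left _ (by positivity)
      apply h.sum_window_le (x := x - i)
      intro n hn
      obtain ⟨h1, h2⟩ := Finset.mem_filter.mp hn
      rw [← h2]
      exact abs_sub_logFloor_le (hA n h1)
    refine (Finset.sum_le_sum h3).trans ?_
    rw [← Finset.sum_mul]
    have hq : Real.exp (-(1 / 2)) ≤ 2 / 3 := by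
      rw [Real.exp_neg, inv_le_comm₀ (Real.exp_pos _) (by norm_num)]
      have := Real.add_one_le_exp (1 / 2 : ℝ)
      linarith
    have hgeom : ∑ i ∈ Finset.range M, Real.exp (-(1 / 2)) ^ i ≤ 3 := by
      calc _ ≤ ∑ i ∈ Finset.range M, (2 / 3 : ℝ) ^ i := by gcongr
        _ ≤ ∑' i : ℕ, (2 / 3 : ℝ) ^ i :=
            (summable_geometric_of_lt_one (by norm_num) (by norm_num)).sum_le_tsum _
              fun _ _ => by positivity
        _ = 3 := by rw [tsum_geometric_of_lt_one (by norm_num) (by norm_num)]; norm_num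
    nlinarith
  calc lam * A.card = ∑ n ∈ A, lam := by simp; ring
    _ ≤ ∑ n ∈ A, Real.exp (α * x) * (Real.exp (-(1 / 2)) ^ logFloor x n * ω n) :=
        Finset.sum_le_sum h1
    _ ≤ _ := by
        rw [← Finset.mul_sum, mul_comm]
        gcongr

theorem fejer_le_sum_windows {u : ℝ} {R M : ℕ} (hR : 0 < R) (hu : R < |u|) (hM : |u| < M) :
    fejer (1 / 7) u ≤ ∑ i ∈ Finset.Ico R M, 588 / (i : ℝ) ^ 2 *
      (fejer (1 / 7) (u + i) + fejer (1 / 7) (u - i)) := by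
  have hu0 : 0 < |u| := lt_trans (by exact_mod_cast hR) hu
  set i := ⌊|u|⌋₊ with hi
  have h1 := Nat.floor_le hu0.le
  have h2 := Nat.lt_floor_add_one |u|
  rw [← hi] at h1 h2
  have hRi : R ≤ i := Nat.le_floor hu.le
  have hiM : i < M := by exact_mod_cast h1.trans_lt hM
  have hi0 : (0 : ℝ) < i := by exact_mod_cast hR.trans_le hRi
  have hs := Finset.single_le_sum (f := fun i : ℕ => 588 / (i : ℝ) ^ 2 *
      (fejer (1 / 7) (u + i) + fejer (1 / 7) (u - i)))
    (fun j _ => by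
      have := fejer_nonneg (1 / 7) (u + j)
      have := fejer_nonneg (1 / 7) (u - j)
      positivity) (Finset.mem_Ico.mpr ⟨hRi, hiM⟩)
  refine le_trans ?_ hs
  have h3 : 1 / 3 ≤ fejer (1 / 7) (u + i) + fejer (1 / 7) (u - i) := by
    rcases abs_cases u with ⟨e, _⟩ | ⟨e, _⟩ <;> rw [e] at h1 h2
    · have := one_third_le_fejer (T := 1 / 7) (u := u - i) (by rw [abs_le]; constructor <;> linarith)
      have := fejer_nonneg (1 / 7) (u + i)
      linarith
    · have := one_third_le_fejer (T := 1 / 7) (u := u + i) (by rw [abs_le]; constructor <;> linarith)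
      have := fejer_nonneg (1 / 7) (u - i)
      linarith
  have h4 : fejer (1 / 7) u ≤ 196 / |u| ^ 2 := by
    have := fejer_le_inv_sq (T := 1 / 7) (by norm_num) hu0
    rcases abs_cases u with ⟨e, _⟩ | ⟨e, _⟩ <;> rw [e] at this ⊢
    · norm_num at this ⊢; exact this
    · rw [fejer_neg] at this; norm_num at this ⊢; exact this
  calc _ ≤ 196 / (i : ℝ) ^ 2 := h4.trans (by gcongr)
    _ = 588 / (i : ℝ) ^ 2 * (1 / 3) := by ring
    _ ≤ _ := by gcongr

theorem sum_Ico_inv_sq_le {R : ℕ} (hR : 0 < R) (M : ℕ) :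
    ∑ i ∈ Finset.Ico R M, (1 : ℝ) / (i : ℝ) ^ 2 ≤ 2 / (R : ℝ) := by
  have := sum_Ioo_inv_sq_le (α := ℝ) (R - 1) M
  have e : Finset.Ioo (R - 1) M = Finset.Ico R M := by
    ext i; simp; omega
  rw [e] at this
  simp only [one_div]
  refine this.trans (le_of_eq ?_)
  rw [Nat.cast_sub (by omega)]; simp

theorem sum_tail_le (h : IsScaledDensity F α lam C ω) {A : Finset ℕ} {x : ℝ} {R : ℕ} (hR : 0 < R)
    (hA : ∀ n ∈ A, R < |x - Real.log n|) :
    ∑ n ∈ A, ω n * fejer (1 / 7) (x - Real.log n) ≤ 2352 * C / R := by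
  have hC := h.bound_nonneg
  obtain ⟨M, hM⟩ : ∃ M : ℕ, ∀ n ∈ A, |x - Real.log n| < M := by
    refine ⟨(A.sup fun n => ⌊|x - Real.log n|⌋₊) + 1, fun n hn => ?_⟩
    have h1 := Nat.lt_floor_add_one |x - Real.log n|
    have h2 : ⌊|x - Real.log n|⌋₊ ≤ A.sup fun n : ℕ => ⌊|x - Real.log n|⌋₊ :=
      Finset.le_sup (f := fun n : ℕ => ⌊|x - Real.log n|⌋₊) hn
    have h3 : (⌊|x - Real.log n|⌋₊ : ℝ) ≤ (A.sup fun n : ℕ => ⌊|x - Real.log n|⌋₊ : ℕ) := by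
      exact_mod_cast h2
    push_cast
    linarith
  calc _ ≤ ∑ n ∈ A, ω n * ∑ i ∈ Finset.Ico R M, 588 / (i : ℝ) ^ 2 *
        (fejer (1 / 7) (x - Real.log n + i) + fejer (1 / 7) (x - Real.log n - i)) :=
        Finset.sum_le_sum fun n hn => mul_le_mul_of_nonneg_left
          (fejer_le_sum_windows hR (hA n hn) (hM n hn)) (h.nonneg n)
    _ = ∑ i ∈ Finset.Ico R M, 588 / (i : ℝ) ^ 2 *
        (∑ n ∈ A, ω n * fejer (1 / 7) (x + i - Real.log n) +
          ∑ n ∈ A, ω n * fejer (1 / 7) (x - i - Real.log n)) := by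
        simp only [Finset.mul_sum]
        rw [Finset.sum_comm]
        apply Finset.sum_congr rfl
        intro i _
        rw [← Finset.sum_add_distrib, Finset.mul_sum]
        apply Finset.sum_congr rfl
        intro n _
        rw [show x - Real.log n + i = x + i - Real.log n by ring,
          show x - Real.log n - i = x - i - Real.log n by ring]
        ring
    _ ≤ ∑ i ∈ Finset.Ico R M, 588 / (i : ℝ) ^ 2 * (C + C) := by
        gcongr
        · exact h.sum_mul_fejer_le A _
        · exact h.sum_mul_fejer_le A _
    _ = 1176 * C * ∑ i ∈ Finset.Ico R M, 1 / (i : ℝ) ^ 2 := by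
        rw [Finset.mul_sum]
        exact Finset.sum_congr rfl fun i _ => by ring
    _ ≤ 1176 * C * (2 / R) := by gcongr; exact sum_Ico_inv_sq_le hR M
    _ = _ := by ring

/-- A positive proportion of the mass near `x` comes from a bounded window. -/
theorem exists_finset_window (h : IsScaledDensity F α lam C ω) {x c : ℝ} {R : ℕ} (hR : 0 < R)
    (hc : 0 < c) (hx : c ≤ kernelMass ω x) (hRc : 2352 * C / R ≤ c / 4) :
    ∃ A : Finset ℕ, (∀ n ∈ A, n ∈ F ∧ |x - Real.log n| ≤ R) ∧ c / 4 ≤ ∑ n ∈ A, ω n := by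
  have hs := (h.summable_mul_fejer x).hasSum
  obtain ⟨B, hB⟩ := (hs.eventually_const_lt (show c / 2 < kernelMass ω x by linarith)).exists
  classical
  refine ⟨B.filter fun n => n ∈ F ∧ |x - Real.log n| ≤ R, fun n hn => (Finset.mem_filter.mp hn).2, ?_⟩
  have h1 : ∀ n ∈ B, ω n * fejer (1 / 7) (x - Real.log n) ≤
      (if n ∈ F ∧ |x - Real.log n| ≤ R then ω n else 0) +
      (if R < |x - Real.log n| then ω n * fejer (1 / 7) (x - Real.log n) else 0) := by
    intro n _
    have h0 := h.nonneg n
    have hf := fejer_le_one (1 / 7) (x - Real.log n)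
    by_cases hn : n ∈ F
    · by_cases hr : |x - Real.log n| ≤ R
      · rw [if_pos ⟨hn, hr⟩, if_neg (not_lt.mpr hr)]; nlinarith
      · rw [if_neg (fun h => hr h.2), if_pos (not_le.mp hr)]; linarith
    · rw [h.apply_of_notMem n hn]; simp
  have h2 := Finset.sum_le_sum h1
  rw [Finset.sum_add_distrib, ← Finset.sum_filter, ← Finset.sum_filter] at h2
  have h3 := h.sum_tail_le (A := B.filter fun n => R < |x - Real.log n|) hR
    fun n hn => (Finset.mem_filter.mp hn).2
  linarith

end IsScaledDensity

/-- The weighted average number of divisors of `a` among `j 0, …, j (L - 1)`. -/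
noncomputable def divisorAverage (α : ℝ) (j : ℕ → ℕ) (L a : ℕ) : ℝ :=
  (∑ l ∈ Finset.range L, if j l ∣ a then (j l : ℝ) ^ α else 0) / L

/-- The second moment of `divisorAverage - 1` against the mass of `ω` near `exp x`. -/
noncomputable def divisorVariance (α : ℝ) (ω : ℕ → ℝ) (j : ℕ → ℕ) (L : ℕ) (x : ℝ) : ℝ :=
  (∑ l ∈ Finset.range L, ∑ l' ∈ Finset.range L, (Nat.gcd (j l) (j l') : ℝ) ^ α *
    kernelMass ω (x - Real.log (Nat.lcm (j l) (j l')))) / (L : ℝ) ^ 2 -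
  2 * (∑ l ∈ Finset.range L, kernelMass ω (x - Real.log (j l))) / L + kernelMass ω x

namespace IsScaledDensity

variable {F : Set ℕ} {α lam C : ℝ} {ω : ℕ → ℝ}

theorem lcm_mem (h : IsScaledDensity F α lam C ω) {a b : ℕ} (ha : a ∈ F) (hb : b ∈ F) :
    Nat.lcm a b ∈ F := by
  have h1 : a.gcd b * a.lcm b ∈ F := by
    rw [Nat.gcd_mul_lcm]
    exact (h.mul_mem_iff _ _).mpr ⟨ha, hb⟩
  exact ((h.mul_mem_iff _ _).mp h1).2

theorem apply_mul (h : IsScaledDensity F α lam C ω) {d : ℕ} (hd : d ∈ F) (m : ℕ) :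
    ω (d * m) = (d : ℝ) ^ (-α) * ω m := by
  by_cases hm : m ∈ F
  · rw [h.apply_of_mem _ ((h.mul_mem_iff _ _).mpr ⟨hd, hm⟩), h.apply_of_mem _ hm, Nat.cast_mul,
      Real.mul_rpow (by positivity) (by positivity)]
    ring
  · rw [h.apply_of_notMem _ hm, mul_zero, h.apply_of_notMem]
    exact fun hdm => hm ((h.mul_mem_iff _ _).mp hdm).2

theorem hasSum_multiples (h : IsScaledDensity F α lam C ω) {d : ℕ} (hd : d ∈ F) (x : ℝ) :
    HasSum (fun a : ℕ => if d ∣ a then ω a * fejer (1 / 7) (x - Real.log a) else 0)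
      ((d : ℝ) ^ (-α) * kernelMass ω (x - Real.log d)) := by
  have hd0 := h.pos_of_mem d hd
  have hinj : Function.Injective fun m : ℕ => d * m := fun a b hab =>
    Nat.eq_of_mul_eq_mul_left hd0 hab
  rw [← hinj.hasSum_iff]
  · refine ((h.summable_mul_fejer (x - Real.log d)).hasSum.mul_left ((d : ℝ) ^ (-α))).congr_fun ?_
    intro m
    simp only [Function.comp_apply, dvd_mul_right, if_true]
    rw [h.apply_mul hd]
    by_cases hm : m ∈ F
    · have hm0 := h.pos_of_mem m hm
      rw [Nat.cast_mul, Real.log_mul (by positivity) (by positivity), sub_sub]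
      ring
    · rw [h.apply_of_notMem m hm]; ring
  · intro a ha
    rw [if_neg]
    rintro ⟨m, rfl⟩
    exact ha ⟨m, rfl⟩

theorem hasSum_variance (h : IsScaledDensity F α lam C ω) {j : ℕ → ℕ} {L : ℕ} (hL : 0 < L)
    (hj : ∀ l < L, j l ∈ F) (x : ℝ) :
    HasSum (fun a : ℕ => ω a * fejer (1 / 7) (x - Real.log a) * (divisorAverage α j L a - 1) ^ 2)
      (divisorVariance α ω j L x) := by
  have hL0 : (L : ℝ) ≠ 0 := by positivity
  have hpos : ∀ l ∈ Finset.range L, (0 : ℝ) < j l := fun l hl => by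
    exact_mod_cast h.pos_of_mem _ (hj l (Finset.mem_range.mp hl))
  have h1 : HasSum (fun a : ℕ => ∑ l ∈ Finset.range L, (j l : ℝ) ^ α *
      if j l ∣ a then ω a * fejer (1 / 7) (x - Real.log a) else 0)
      (∑ l ∈ Finset.range L, kernelMass ω (x - Real.log (j l))) := by
    apply hasSum_sum
    intro l hl
    have h0 := (h.hasSum_multiples (hj l (Finset.mem_range.mp hl)) x).mul_left ((j l : ℝ) ^ α)
    rwa [← mul_assoc, ← Real.rpow_add (hpos l hl), add_neg_cancel, Real.rpow_zero, one_mul] at h0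
  have h2 : HasSum (fun a : ℕ => ∑ l ∈ Finset.range L, ∑ l' ∈ Finset.range L,
      ((j l : ℝ) ^ α * (j l' : ℝ) ^ α) *
      if Nat.lcm (j l) (j l') ∣ a then ω a * fejer (1 / 7) (x - Real.log a) else 0)
      (∑ l ∈ Finset.range L, ∑ l' ∈ Finset.range L, (Nat.gcd (j l) (j l') : ℝ) ^ α *
        kernelMass ω (x - Real.log (Nat.lcm (j l) (j l')))) := by
    apply hasSum_sum
    intro l hl
    apply hasSum_sum
    intro l' hl'
    have hm := h.lcm_mem (hj l (Finset.mem_range.mp hl)) (hj l' (Finset.mem_range.mp hl'))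
    have h3 : (0 : ℝ) < Nat.lcm (j l) (j l') := by exact_mod_cast h.pos_of_mem _ hm
    have h4 : (j l : ℝ) ^ α * (j l' : ℝ) ^ α * (Nat.lcm (j l) (j l') : ℝ) ^ (-α) =
        (Nat.gcd (j l) (j l') : ℝ) ^ α := by
      rw [← Real.mul_rpow (hpos l hl).le (hpos l' hl').le, ← Nat.cast_mul, ← Nat.gcd_mul_lcm,
        Nat.cast_mul, Real.mul_rpow (by positivity) h3.le, mul_assoc, ← Real.rpow_add h3,
        add_neg_cancel, Real.rpow_zero, mul_one]
    have h0 := (h.hasSum_multiples hm x).mul_left ((j l : ℝ) ^ α * (j l' : ℝ) ^ α)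
    rwa [← mul_assoc, h4] at h0
  have h3 := ((h2.div_const ((L : ℝ) ^ 2)).sub ((h1.mul_left 2).div_const (L : ℝ))).add
    (h.summable_mul_fejer x).hasSum
  refine h3.congr_fun fun a => ?_
  simp only [divisorAverage]
  set k := ω a * fejer (1 / 7) (x - Real.log a)
  have e1 : (∑ l ∈ Finset.range L, (j l : ℝ) ^ α * if j l ∣ a then k else 0) =
      k * ∑ l ∈ Finset.range L, if j l ∣ a then (j l : ℝ) ^ α else 0 := by
    rw [Finset.mul_sum]
    refine Finset.sum_congr rfl fun l _ => ?_
    split_ifs <;> ring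
  have e2 : (∑ l ∈ Finset.range L, ∑ l' ∈ Finset.range L, ((j l : ℝ) ^ α * (j l' : ℝ) ^ α) *
      if Nat.lcm (j l) (j l') ∣ a then k else 0) =
      k * (∑ l ∈ Finset.range L, if j l ∣ a then (j l : ℝ) ^ α else 0) ^ 2 := by
    rw [sq, Finset.sum_mul_sum, Finset.mul_sum]
    refine Finset.sum_congr rfl fun l _ => ?_
    rw [Finset.mul_sum]
    refine Finset.sum_congr rfl fun l' _ => ?_
    simp only [Nat.lcm_dvd_iff]
    by_cases p : j l ∣ a <;> by_cases q : j l' ∣ a <;> simp [p, q]; ring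
  rw [e1, e2]
  field_simp
  ring

theorem sum_sq_divisorAverage_le (h : IsScaledDensity F α lam C ω) {j : ℕ → ℕ} {L : ℕ} (hL : 0 < L)
    (hj : ∀ l < L, j l ∈ F) {A : Finset ℕ} {x v : ℝ} {I : ℕ}
    (hA : ∀ n ∈ A, Real.log n ≤ x ∧ x - I ≤ Real.log n)
    (hv : ∀ i ≤ I, divisorVariance α ω j L (x - i) ≤ v) :
    ∑ a ∈ A, ω a * (divisorAverage α j L a - 1) ^ 2 ≤ 3 * (I + 1) * v := by
  have hmaps : ∀ n ∈ A, logFloor x n ∈ Finset.range (I + 1) := by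
    intro n hn
    rw [Finset.mem_range, Nat.lt_succ_iff]
    apply Nat.floor_le_of_le
    linarith [(hA n hn).2]
  rw [← Finset.sum_fiberwise_of_maps_to hmaps]
  calc _ ≤ ∑ i ∈ Finset.range (I + 1), 3 * v := by
        apply Finset.sum_le_sum
        intro i hi
        have h1 := sum_le_hasSum (A.filter fun n => logFloor x n = i)
          (fun a _ => mul_nonneg (mul_nonneg (h.nonneg a) (fejer_nonneg _ _)) (sq_nonneg _))
          (h.hasSum_variance hL hj (x - i))
        have h2 := hv i (Nat.lt_succ_iff.mp (Finset.mem_range.mp hi))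
        have h3 : (∑ a ∈ A with logFloor x a = i, ω a * (divisorAverage α j L a - 1) ^ 2) ≤
            ∑ a ∈ A with logFloor x a = i, 3 * (ω a * fejer (1 / 7) (x - i - Real.log a) *
              (divisorAverage α j L a - 1) ^ 2) := by
          apply Finset.sum_le_sum
          intro n hn
          obtain ⟨hn1, hn2⟩ := Finset.mem_filter.mp hn
          have h4 : 1 / 3 ≤ fejer (1 / 7) (x - i - Real.log n) := by
            apply one_third_le_fejer
            rw [abs_mul, abs_of_pos (by norm_num), ← hn2]
            linarith [abs_sub_logFloor_le (hA n hn1).1]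
          have h5 := mul_nonneg (h.nonneg n) (sq_nonneg (divisorAverage α j L n - 1))
          nlinarith
        rw [← Finset.mul_sum] at h3
        linarith
    _ = _ := by simp; ring

theorem sum_mul_divisorAverage (h : IsScaledDensity F α lam C ω) {j : ℕ → ℕ} {L : ℕ}
    (hj : ∀ l < L, j l ∈ F) {A M : Finset ℕ}
    (hM : ∀ l < L, ∀ m, j l * m ∈ A → m ∈ M) :
    ∑ a ∈ A, ω a * divisorAverage α j L a =
      (∑ m ∈ M, ω m * ((Finset.range L).filter fun l => j l * m ∈ A).card) / L := by
  simp only [divisorAverage, mul_div_assoc', ← Finset.sum_div]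
  congr 1
  simp only [Finset.mul_sum, Finset.card_filter, Nat.cast_sum]
  rw [Finset.sum_comm, Finset.sum_comm (s := M)]
  refine Finset.sum_congr rfl fun l hl => ?_
  have hl := Finset.mem_range.mp hl
  have hpos := h.pos_of_mem _ (hj l hl)
  simp only [mul_ite, mul_zero, ← Finset.sum_filter, Nat.cast_ite, Nat.cast_one, Nat.cast_zero,
    mul_one]
  refine Finset.sum_nbij' (fun a => a / j l) (fun m => j l * m) ?_ ?_ ?_ ?_ ?_
  · intro a ha
    obtain ⟨h1, h2⟩ := Finset.mem_filter.mp ha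
    have h3 : j l * (a / j l) ∈ A := by rwa [Nat.mul_div_cancel' h2]
    exact Finset.mem_filter.mpr ⟨hM l hl _ h3, h3⟩
  · intro m hm
    exact Finset.mem_filter.mpr ⟨(Finset.mem_filter.mp hm).2, dvd_mul_right _ _⟩
  · intro a ha
    exact Nat.mul_div_cancel' (Finset.mem_filter.mp ha).2
  · intro m _
    exact Nat.mul_div_cancel_left _ hpos
  · intro a ha
    obtain ⟨m, rfl⟩ := (Finset.mem_filter.mp ha).2
    have hp : (0 : ℝ) < j l := by exact_mod_cast hpos
    rw [Nat.mul_div_cancel_left _ hpos, h.apply_mul (hj l hl), mul_right_comm,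
      ← Real.rpow_add hp, neg_add_cancel, Real.rpow_zero, one_mul]

/-- If the divisor averages concentrate around `1`, then a set of positive mass contains a positive
proportion of `j 0 * m, …, j (L - 1) * m` for some `m`. -/
theorem exists_many_dilates (h : IsScaledDensity F α lam C ω) {j : ℕ → ℕ} {L : ℕ} (hL : 0 < L)
    (hj : ∀ l < L, j l ∈ F) {A : Finset ℕ} {x v D s ε : ℝ} {I : ℕ} (hAF : ∀ a ∈ A, a ∈ F)
    (hjD : ∀ l < L, D ≤ Real.log (j l) ∧ Real.log (j l) ≤ D + 1) (hε : 0 < ε)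
    (hA : ∀ n ∈ A, Real.log n ≤ x ∧ x - I ≤ Real.log n)
    (hv : ∀ i ≤ I, divisorVariance α ω j L (x - i) ≤ v) (hs : s ≤ ∑ a ∈ A, ω a)
    (hvs : 3 * (I + 1) * v ≤ s / 4) (hεs : ε * (3 * (I + 2) * C) < s / 2) :
    ∃ m, ε * L ≤ ((Finset.range L).filter fun l => j l * m ∈ A).card := by
  by_contra! hcon
  have hL0 : (0 : ℝ) < L := by exact_mod_cast hL
  set M := ((A ×ˢ Finset.range L).filter fun q => j q.2 ∣ q.1).image fun q => q.1 / j q.2 with hMdef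
  have hM : ∀ l < L, ∀ m, j l * m ∈ A → m ∈ M := by
    intro l hl m hm
    refine Finset.mem_image.mpr ⟨(j l * m, l), ?_, ?_⟩
    · simp [hm, hl]
    · exact Nat.mul_div_cancel_left _ (h.pos_of_mem _ (hj l hl))
  have hMI : ∀ m ∈ M, Real.log m ≤ x - D ∧ x - D - (I + 1 : ℕ) ≤ Real.log m := by
    intro m hm
    obtain ⟨⟨a, l⟩, hq, rfl⟩ := Finset.mem_image.mp hm
    simp only [Finset.mem_filter, Finset.mem_product, Finset.mem_range] at hq ⊢
    obtain ⟨⟨ha, hl⟩, m, rfl⟩ := hq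
    rw [Nat.mul_div_cancel_left _ (h.pos_of_mem _ (hj l hl))]
    have hF := (h.mul_mem_iff _ _).mp (hAF _ ha)
    have h1 : (0 : ℝ) < j l := by exact_mod_cast h.pos_of_mem _ hF.1
    have h2 : (0 : ℝ) < m := by exact_mod_cast h.pos_of_mem _ hF.2
    have h3 := hA _ ha
    have h4 := hjD l hl
    rw [Nat.cast_mul, Real.log_mul h1.ne' h2.ne'] at h3
    push_cast
    constructor <;> linarith
  have h1 := h.sum_interval_le hMI
  have h2 := h.sum_sq_divisorAverage_le hL hj hA hv
  have h3 := h.sum_mul_divisorAverage hj hM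
  have h4 : ∑ a ∈ A, ω a * (3 / 4) ≤
      ∑ a ∈ A, (ω a * divisorAverage α j L a + ω a * (divisorAverage α j L a - 1) ^ 2) := by
    apply Finset.sum_le_sum
    intro a _
    rw [← mul_add]
    apply mul_le_mul_of_nonneg_left _ (h.nonneg a)
    nlinarith [sq_nonneg (divisorAverage α j L a - 1 / 2)]
  rw [← Finset.sum_mul, Finset.sum_add_distrib] at h4
  have h5 : (∑ m ∈ M, ω m * ((Finset.range L).filter fun l => j l * m ∈ A).card) / L ≤
      ε * ∑ m ∈ M, ω m := by
    rw [div_le_iff₀ hL0, Finset.mul_sum, Finset.sum_mul]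
    apply Finset.sum_le_sum
    intro m _
    have := mul_le_mul_of_nonneg_left (hcon m).le (h.nonneg m)
    linarith
  have h6 : ε * ∑ m ∈ M, ω m ≤ ε * (3 * (I + 2) * C) := by
    apply mul_le_mul_of_nonneg_left _ hε.le
    push_cast at h1
    linarith
  linarith

theorem divisorVariance_le (h : IsScaledDensity F α lam C ω) {j : ℕ → ℕ} {L : ℕ} (hL : 0 < L)
    (hj : ∀ l < L, j l ∈ F) {x c η κ ε : ℝ} (hα : α ≤ 1 - κ)
    (hgcd : ∑ l ∈ Finset.range L, ∑ l' ∈ Finset.range L, (Nat.gcd (j l) (j l') : ℝ) ^ (1 - κ) ≤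
      (L : ℝ) ^ 2 * (1 + ε))
    (hlcm : ∀ l < L, ∀ l' < L, kernelMass ω (x - Real.log (Nat.lcm (j l) (j l'))) ≤ c + η)
    (hjm : ∀ l < L, c - η ≤ kernelMass ω (x - Real.log (j l))) (hx : kernelMass ω x ≤ c + η) :
    divisorVariance α ω j L x ≤ (c + η) * (1 + ε) - 2 * (c - η) + (c + η) := by
  have hL0 : (0 : ℝ) < L := by exact_mod_cast hL
  have hcη := (h.kernelMass_nonneg x).trans hx
  unfold divisorVariance
  refine add_le_add (sub_le_sub ?_ ?_) hx
  · rw [div_le_iff₀ (by positivity)]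
    calc _ ≤ ∑ l ∈ Finset.range L, ∑ l' ∈ Finset.range L,
          (Nat.gcd (j l) (j l') : ℝ) ^ (1 - κ) * (c + η) := by
          refine Finset.sum_le_sum fun l hl => Finset.sum_le_sum fun l' hl' => ?_
          have hl := Finset.mem_range.mp hl
          have hl' := Finset.mem_range.mp hl'
          have h1 : (1 : ℝ) ≤ Nat.gcd (j l) (j l') := by
            exact_mod_cast Nat.gcd_pos_of_pos_left _ (h.pos_of_mem _ (hj l hl))
          exact mul_le_mul (Real.rpow_le_rpow_of_exponent_le h1 hα) (hlcm l hl l' hl')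
            (h.kernelMass_nonneg _) (by positivity)
      _ ≤ (L : ℝ) ^ 2 * (1 + ε) * (c + η) := by
          simp only [← Finset.sum_mul]
          gcongr
      _ = _ := by ring
  · rw [le_div_iff₀ hL0]
    have h1 : ∑ l ∈ Finset.range L, (c - η) ≤
        ∑ l ∈ Finset.range L, kernelMass ω (x - Real.log (j l)) :=
      Finset.sum_le_sum fun l hl => hjm l (Finset.mem_range.mp hl)
    rw [Finset.sum_const, Finset.card_range, nsmul_eq_mul] at h1
    linarith

theorem mul_card_eq (h : IsScaledDensity F α lam C ω) {A : Finset ℕ} (hAF : ∀ n ∈ A, n ∈ F) :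
    lam * A.card = ∑ n ∈ A, Real.exp (α * Real.log n) * ω n := by
  have : ∀ n ∈ A, Real.exp (α * Real.log n) * ω n = lam := by
    intro n hn
    have hn0 : (0 : ℝ) < n := by exact_mod_cast h.pos_of_mem n (hAF n hn)
    rw [h.apply_of_mem n (hAF n hn), Real.rpow_def_of_pos hn0, mul_left_comm, ← Real.exp_add]
    ring_nf
    simp
  rw [Finset.sum_congr rfl this, Finset.sum_const, nsmul_eq_mul, mul_comm]

theorem mul_card_le_sum (h : IsScaledDensity F α lam C ω) {A : Finset ℕ} {x : ℝ}
    (hAF : ∀ n ∈ A, n ∈ F) (hA : ∀ n ∈ A, Real.log n ≤ x) :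
    lam * A.card ≤ Real.exp (α * x) * ∑ n ∈ A, ω n := by
  have hα := h.half_le
  rw [h.mul_card_eq hAF, Finset.mul_sum]
  refine Finset.sum_le_sum fun n hn => mul_le_mul_of_nonneg_right ?_ (h.nonneg n)
  have := hA n hn
  gcongr

theorem sum_le_mul_card (h : IsScaledDensity F α lam C ω) {A : Finset ℕ} {x D : ℝ} (hD : 0 ≤ D)
    (hAF : ∀ n ∈ A, n ∈ F) (hA : ∀ n ∈ A, x - D ≤ Real.log n) :
    Real.exp (α * x) * (Real.exp (-D) * ∑ n ∈ A, ω n) ≤ lam * A.card := by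
  have hα := h.half_le
  have hα1 := h.le_one
  rw [h.mul_card_eq hAF, ← mul_assoc, ← Real.exp_add, Finset.mul_sum]
  refine Finset.sum_le_sum fun n hn => mul_le_mul_of_nonneg_right ?_ (h.nonneg n)
  have := hA n hn
  rw [Real.exp_le_exp]
  nlinarith

/-- A dense subset of a large set has large mass in a bounded window. -/
theorem le_sum_filter_of_dense (h : IsScaledDensity F α lam C ω) {A S : Finset ℕ} {x δ c : ℝ}
    {I : ℕ} (hδ : 0 < δ) (hAF : ∀ n ∈ A, n ∈ F) (hA : ∀ n ∈ A, Real.log n ≤ x)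
    (hS : Real.exp (α * x) * c ≤ lam * S.card) (hAS : δ * S.card ≤ A.card)
    (hI : 9 * C * Real.exp (-((I : ℝ) / 2)) ≤ δ / 2 * c) :
    δ / 2 * c ≤ ∑ n ∈ A.filter (fun n : ℕ => x - I ≤ Real.log n), ω n := by
  have hα := h.half_le
  have hlam := h.lam_pos
  have hC := h.bound_nonneg
  have h1 := h.mul_card_le_sum (A := A.filter fun n : ℕ => x - I ≤ Real.log n) (x := x)
    (fun n hn => hAF n (Finset.mem_filter.mp hn).1) (fun n hn => hA n (Finset.mem_filter.mp hn).1)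
  have h2 := h.card_le (A := A.filter fun n : ℕ => ¬ x - I ≤ Real.log n) (x := x - I)
    (fun n hn => hAF n (Finset.mem_filter.mp hn).1)
    (fun n hn => (not_le.mp (Finset.mem_filter.mp hn).2).le)
  have h3 : ((A.filter fun n : ℕ => x - I ≤ Real.log n).card : ℝ) +
      (A.filter fun n : ℕ => ¬ x - I ≤ Real.log n).card = A.card := by
    exact_mod_cast Finset.card_filter_add_card_filter_not _
  have h4 : 9 * C * Real.exp (α * (x - I)) ≤ Real.exp (α * x) * (δ / 2 * c) := by
    calc 9 * C * Real.exp (α * (x - I)) ≤ 9 * C * Real.exp (α * x + -((I : ℝ) / 2)) := by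
          gcongr
          have : (0 : ℝ) ≤ I := by positivity
          nlinarith
      _ = Real.exp (α * x) * (9 * C * Real.exp (-((I : ℝ) / 2))) := by
          rw [Real.exp_add]; ring
      _ ≤ _ := by gcongr
  have h5 : Real.exp (α * x) * (δ / 2 * c) ≤ Real.exp (α * x) *
      ∑ n ∈ A.filter (fun n : ℕ => x - I ≤ Real.log n), ω n := by
    have h6 := mul_le_mul_of_nonneg_left hS hδ.le
    have h7 := mul_le_mul_of_nonneg_left hAS hlam.le
    rw [← h3, mul_add] at h7
    linarith
  exact le_of_mul_le_mul_left h5 (Real.exp_pos _)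

end IsScaledDensity

theorem kernelMass_mul_smoothWeight (P : Finset ℕ) (α σ x : ℝ) :
    kernelMass (fun n => σ * smoothWeight P α n) x = σ * smoothMass P α (1 / 7) x := by
  unfold kernelMass smoothMass
  rw [← tsum_mul_left]
  exact tsum_congr fun n => mul_assoc _ _ _

theorem mul_mem_factoredNumbers_iff {P : Finset ℕ} (a b : ℕ) :
    a * b ∈ Nat.factoredNumbers P ↔ a ∈ Nat.factoredNumbers P ∧ b ∈ Nat.factoredNumbers P := by
  constructor
  · intro h
    exact ⟨Nat.mem_factoredNumbers_of_dvd h (dvd_mul_right _ _),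
      Nat.mem_factoredNumbers_of_dvd h (dvd_mul_left _ _)⟩
  · rintro ⟨ha, hb⟩
    exact Nat.mul_mem_factoredNumbers ha hb

theorem isScaledDensity_smoothWeight {P : Finset ℕ} (hP : ∀ p ∈ P, p.Prime) {α σ C : ℝ}
    (hα : 1 / 2 ≤ α) (hα1 : α ≤ 1) (hσ : 0 < σ) (hC : ∀ x, σ * smoothMass P α (1 / 7) x ≤ C) :
    IsScaledDensity (Nat.factoredNumbers P) α (σ / eulerMass P α) C
      (fun n => σ * smoothWeight P α n) where
  pos_of_mem n hn := Nat.pos_of_ne_zero hn.1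
  mul_mem_iff := mul_mem_factoredNumbers_iff
  lam_pos := div_pos hσ (eulerMass_pos hP (by linarith))
  half_le := hα
  le_one := hα1
  apply_of_mem n hn := by
    rw [smoothWeight, Set.indicator_of_mem hn]; ring
  apply_of_notMem n hn := by
    rw [smoothWeight, Set.indicator_of_notMem hn, mul_zero]
  summable := (hasSum_smoothWeight_mul_exp hP (by linarith) 0).1.mul_left σ
  mass_le x := by rw [kernelMass_mul_smoothWeight]; exact hC x

theorem mem_smoothSet_iff {N n : ℕ} {y : ℝ} (hy : 0 ≤ y) :
    n ∈ smoothSet N y ↔ n ∈ Nat.factoredNumbers (primesUpTo y) ∧ n ≤ N := by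
  simp only [smoothSet, Finset.mem_filter, Finset.mem_Icc, Nat.mem_factoredNumbers,
    Nat.mem_primeFactorsList', Nat.mem_primeFactors, mem_primesUpTo hy]
  constructor
  · rintro ⟨⟨h1, h2⟩, h3⟩
    exact ⟨⟨by omega, fun p hp => ⟨h3 p hp, hp.1⟩⟩, h2⟩
  · rintro ⟨⟨h1, h2⟩, h3⟩
    exact ⟨⟨by omega, h3⟩, fun p hp => (h2 p hp).1⟩

theorem mem_factoredNumbers_primesUpTo {d : ℕ} {y : ℝ} (hd : 0 < d) (hdy : (d : ℝ) ≤ y) :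
    d ∈ Nat.factoredNumbers (primesUpTo y) := by
  refine Nat.mem_factoredNumbers.mpr ⟨hd.ne', fun p hp => ?_⟩
  rw [mem_primesUpTo ((Nat.cast_nonneg d).trans hdy)]
  refine ⟨le_trans ?_ hdy, Nat.prime_of_mem_primeFactorsList hp⟩
  exact_mod_cast Nat.le_of_mem_primeFactorsList hp

theorem log_dilate_mem {W L l : ℕ} (hl : l < L) :
    Real.log (1 + W * L : ℕ) ≤ Real.log (dilate W L l) ∧
      Real.log (dilate W L l) ≤ Real.log (1 + W * L : ℕ) + 1 := by
  have h0 : (0 : ℝ) < (1 + W * L : ℕ) := by positivity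
  have h1 : 1 + W * L ≤ dilate W L l := by
    unfold dilate; gcongr; omega
  have h2 : dilate W L l ≤ 2 * (1 + W * L) := by
    unfold dilate
    have : W * l ≤ W * L := Nat.mul_le_mul_left _ hl.le
    rw [mul_add]; omega
  have h3 : (0 : ℝ) < dilate W L l := by exact_mod_cast dilate_pos W L l
  refine ⟨Real.log_le_log h0 (by exact_mod_cast h1), ?_⟩
  calc Real.log (dilate W L l) ≤ Real.log (2 * (1 + W * L : ℕ)) :=
        Real.log_le_log h3 (by exact_mod_cast h2)
    _ = Real.log 2 + Real.log (1 + W * L : ℕ) := Real.log_mul (by norm_num) h0.ne'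
    _ ≤ _ := by linarith [Real.log_two_lt_d9]

/-- A set containing many dilates of `m` contains a progression, by Roth's theorem. -/
theorem exists_progression_of_dilates {W L m : ℕ} {ε : ℝ} (hW : 0 < W) (hε : 0 < ε) (hm : 0 < m)
    (hL : cornersTheoremBound (ε / 3) ≤ L) {A : Finset ℕ}
    (hA : ε * L ≤ ((Finset.range L).filter fun l => dilate W L l * m ∈ A).card) :
    ∃ n d : ℤ, d ≠ 0 ∧ (∃ a ∈ A, (a : ℤ) = n) ∧ (∃ a ∈ A, (a : ℤ) = n + d) ∧
      (∃ a ∈ A, (a : ℤ) = n + 2 * d) := by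
  have h1 := roth_3ap_theorem_nat ε hε hL _ (Finset.filter_subset _ _) hA
  simp only [ThreeAPFree] at h1
  push Not at h1
  obtain ⟨a, ha, b, hb, c, hc, he, hne⟩ := h1
  simp only [Finset.coe_filter, Set.mem_ofPred_eq] at ha hb hc
  refine ⟨dilate W L a * m, W * (b - a) * m, ?_, ⟨_, ha.2, by push_cast; rfl⟩, ⟨_, hb.2, ?_⟩,
    ⟨_, hc.2, ?_⟩⟩
  · have : (b : ℤ) - a ≠ 0 := by omega
    exact mul_ne_zero (mul_ne_zero (by omega) this) (by omega)
  · unfold dilate; push_cast; ring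
  · have he' : (c : ℤ) = 2 * b - a := by omega
    unfold dilate; push_cast; rw [he']; ring

theorem tendsto_log_pow_atTop {K : ℕ} (hK : K ≠ 0) :
    Tendsto (fun N : ℕ => Real.log N ^ K) atTop atTop :=
  (tendsto_pow_atTop hK).comp (Real.tendsto_log_atTop.comp tendsto_natCast_atTop_atTop)

theorem eventually_exists_progression {K : ℕ} (hK : 4 ≤ K) {δ : ℝ} (hδ : 0 < δ) :
    ∀ᶠ N : ℕ in atTop, ∀ A : Finset ℕ, A ⊆ smoothSet N (Real.log N ^ K) →
      δ * (Psi N (Real.log N ^ K) : ℝ) ≤ A.card →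
        ∃ n d : ℤ, d ≠ 0 ∧ (∃ a ∈ A, (a : ℤ) = n) ∧ (∃ a ∈ A, (a : ℤ) = n + d) ∧
          (∃ a ∈ A, (a : ℤ) = n + 2 * d) := by
  obtain ⟨α, σ, C₀, c, hc, hα, hC₀, hlim⟩ := exists_smoothMass_asymptotics hK
  set C := max C₀ 1 with hCdef
  have hC : 0 < C := lt_max_of_lt_right one_pos
  have hK0 : (4 : ℝ) ≤ K := by exact_mod_cast hK
  obtain ⟨R, hR⟩ := exists_nat_gt (2352 * C * 8 / c)
  have hR0 : (0 : ℝ) < R := lt_trans (by positivity) hR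
  have hRc : 2352 * C / R ≤ c / 2 / 4 := by
    rw [div_lt_iff₀ hc] at hR
    rw [div_le_iff₀ hR0]
    linarith
  set c₁ := Real.exp (-(2 * R)) * (c / 2 / 4) with hc₁def
  have hc₁ : 0 < c₁ := by positivity
  set s := δ / 2 * c₁ with hsdef
  have hs : 0 < s := by positivity
  obtain ⟨I, hI⟩ := exists_nat_gt (-(2 * Real.log (s / (9 * C))))
  have hIs : 9 * C * Real.exp (-((I : ℝ) / 2)) ≤ s := by
    have : Real.exp (-((I : ℝ) / 2)) ≤ s / (9 * C) := by
      rw [← Real.le_log_iff_exp_le (by positivity)]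
      linarith
    rw [le_div_iff₀ (by positivity)] at this
    linarith
  set ε := s / (3 * (3 * (I + 2) * C)) with hεdef
  have hε : 0 < ε := by positivity
  have hεs : ε * (3 * (I + 2) * C) < s / 2 := by
    have : ε * (3 * (I + 2) * C) = s / 3 := by
      rw [hεdef]; field_simp
    linarith
  set v := s / (12 * (I + 1)) with hvdef
  have hv : 0 < v := by positivity
  have hvs : 3 * (I + 1) * v ≤ s / 4 := by
    rw [hvdef]; apply le_of_eq; field_simp; norm_num
  set ε' := v / (2 * c) with hε'def
  have hε' : 0 < ε' := by positivity
  set η := v / (2 * (4 + ε')) with hηdef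
  have hη : 0 < η := by positivity
  have hηv : (c + η) * (1 + ε') - 2 * (c - η) + (c + η) = v := by
    have h1 : c * ε' = v / 2 := by rw [hε'def]; field_simp
    have h2 : η * (4 + ε') = v / 2 := by rw [hηdef]; field_simp
    linarith
  obtain ⟨W, hW, hWL⟩ := exists_sum_gcd_dilate_le (κ := 1 / (2 * K)) (by positivity)
    (by rw [div_le_one (by positivity)]; linarith) hε'
  obtain ⟨L, hgcd, hL, hLc⟩ := (hWL.and ((eventually_gt_atTop 0).and
    (eventually_ge_atTop (cornersTheoremBound (ε / 3))))).exists
  have hnear : ∀ h : ℝ, ∀ᶠ N : ℕ in atTop, |σ N * smoothMass (primesUpTo (Real.log N ^ K)) (α N)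
      (1 / 7) (Real.log N - h) - c| < η := fun h => by
    simpa [Real.dist_eq] using Metric.tendsto_nhds.mp (hlim h) η hη
  have hnear₀ : ∀ᶠ N : ℕ in atTop, ∀ i ∈ Finset.range (I + 1), |σ N *
      smoothMass (primesUpTo (Real.log N ^ K)) (α N) (1 / 7) (Real.log N - i) - c| < η :=
    (Finset.eventually_all _).mpr fun i _ => hnear i
  have hnear₁ : ∀ᶠ N : ℕ in atTop, ∀ i ∈ Finset.range (I + 1), ∀ l ∈ Finset.range L, |σ N *
      smoothMass (primesUpTo (Real.log N ^ K)) (α N) (1 / 7)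
        (Real.log N - (i + Real.log (dilate W L l))) - c| < η :=
    (Finset.eventually_all _).mpr fun i _ => (Finset.eventually_all _).mpr fun l _ => hnear _
  have hnear₂ : ∀ᶠ N : ℕ in atTop, ∀ i ∈ Finset.range (I + 1), ∀ l ∈ Finset.range L,
      ∀ l' ∈ Finset.range L, |σ N * smoothMass (primesUpTo (Real.log N ^ K)) (α N) (1 / 7)
        (Real.log N - (i + Real.log (Nat.lcm (dilate W L l) (dilate W L l')))) - c| < η :=
    (Finset.eventually_all _).mpr fun i _ => (Finset.eventually_all _).mpr fun l _ =>
      (Finset.eventually_all _).mpr fun l' _ => hnear _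
  have hlarge : ∀ᶠ N : ℕ in atTop, ((1 + W * (L + L) : ℕ) : ℝ) ≤ Real.log N ^ K :=
    (tendsto_log_pow_atTop (by omega)).eventually_ge_atTop _
  filter_upwards [hα, hC₀, hnear₀, hnear₁, hnear₂, hlarge, eventually_gt_atTop 0,
    (hlim R).eventually_const_le (half_lt_self hc)] with N hα hC₀ hnear₀ hnear₁ hnear₂ hlarge hN hNR
  intro A hAS hA
  set y := Real.log N ^ K with hydef
  have hy : 0 ≤ y := (Nat.cast_nonneg _).trans hlarge
  have hN0 : (0 : ℝ) < N := by exact_mod_cast hN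
  have hκ : α N ≤ 1 - 1 / (2 * K) := hα.2.1
  have hκ0 : (0 : ℝ) < 1 / (2 * K) := by positivity
  have h := isScaledDensity_smoothWeight (P := primesUpTo y)
    (fun p hp => prime_of_mem_primesUpTo hp) hα.1 (by linarith) hα.2.2
    (fun x => (hC₀ x).trans (le_max_left C₀ 1))
  rw [← hCdef] at h
  simp only [← kernelMass_mul_smoothWeight] at hnear₀ hnear₁ hnear₂ hNR
  set ω : ℕ → ℝ := fun n => σ N * smoothWeight (primesUpTo y) (α N) n with hω
  have hlog : ∀ n ∈ Nat.factoredNumbers (primesUpTo y), n ≤ N → Real.log n ≤ Real.log N :=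
    fun n hn hle => Real.log_le_log (by exact_mod_cast h.pos_of_mem n hn) (by exact_mod_cast hle)
  have hAF : ∀ n ∈ A, n ∈ Nat.factoredNumbers (primesUpTo y) := fun n hn =>
    ((mem_smoothSet_iff hy).mp (hAS hn)).1
  have hAN : ∀ n ∈ A, Real.log n ≤ Real.log N := fun n hn =>
    hlog n (hAF n hn) ((mem_smoothSet_iff hy).mp (hAS hn)).2
  have hj : ∀ l < L, dilate W L l ∈ Nat.factoredNumbers (primesUpTo y) := by
    intro l hl
    refine mem_factoredNumbers_primesUpTo (dilate_pos _ _ _) (le_trans ?_ hlarge)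
    have : dilate W L l ≤ 1 + W * (L + L) := by unfold dilate; gcongr
    exact_mod_cast this
  obtain ⟨B, hB, hBs⟩ := h.exists_finset_window (by exact_mod_cast hR0) (half_pos hc) hNR hRc
  have hBS : B ⊆ smoothSet N y := by
    intro n hn
    refine (mem_smoothSet_iff hy).mpr ⟨(hB n hn).1, ?_⟩
    have h1 := (abs_le.mp (hB n hn).2).1
    have h2 : (0 : ℝ) < n := by exact_mod_cast h.pos_of_mem n (hB n hn).1
    have h3 := (Real.log_le_log_iff h2 hN0).mp (by linarith : Real.log n ≤ Real.log N)
    exact_mod_cast h3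
  have hΨ : Real.exp (α N * Real.log N) * c₁ ≤
      σ N / eulerMass (primesUpTo y) (α N) * (smoothSet N y).card := by
    have h1 := h.sum_le_mul_card (A := B) (x := Real.log N) (D := 2 * R) (by positivity)
      (fun n hn => (hB n hn).1) (fun n hn => by linarith [(abs_le.mp (hB n hn).2).2])
    have h2 : ((B.card : ℕ) : ℝ) ≤ (smoothSet N y).card := by
      exact_mod_cast Finset.card_le_card hBS
    calc _ ≤ Real.exp (α N * Real.log N) * (Real.exp (-(2 * R)) * ∑ n ∈ B, ω n) := by
          rw [hc₁def]; gcongr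
      _ ≤ _ := h1
      _ ≤ _ := mul_le_mul_of_nonneg_left h2 h.lam_pos.le
  have hmass := h.le_sum_filter_of_dense hδ hAF hAN hΨ hA hIs
  have hvar : ∀ i ≤ I, divisorVariance (α N) ω (dilate W L) L (Real.log N - i) ≤ v := by
    intro i hi
    have hi' : i ∈ Finset.range (I + 1) := Finset.mem_range.mpr (Nat.lt_succ_of_le hi)
    rw [← hηv]
    refine h.divisorVariance_le hL hj hκ hgcd ?_ ?_ ?_
    · intro l hl l' hl'
      have := (abs_lt.mp (hnear₂ i hi' l (Finset.mem_range.mpr hl) l' (Finset.mem_range.mpr hl'))).2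
      rw [← sub_sub] at this
      linarith
    · intro l hl
      have := (abs_lt.mp (hnear₁ i hi' l (Finset.mem_range.mpr hl))).1
      rw [← sub_sub] at this
      linarith
    · linarith [(abs_lt.mp (hnear₀ i hi')).2]
  set A' := A.filter fun n : ℕ => Real.log N - I ≤ Real.log n with hA'def
  have hA'A : A' ⊆ A := Finset.filter_subset _ _
  obtain ⟨m, hm⟩ := h.exists_many_dilates hL hj (fun a ha => hAF a (hA'A ha))
    (fun l hl => log_dilate_mem hl) hε
    (fun n hn => ⟨hAN n (hA'A hn), (Finset.mem_filter.mp hn).2⟩) hvar hmass hvs hεs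
  have hm0 : 0 < m := by
    by_contra! hm0
    obtain rfl : m = 0 := by omega
    have h0 : 0 ∉ A' := fun h0 => absurd (h.pos_of_mem 0 (hAF 0 (hA'A h0))) (lt_irrefl 0)
    simp only [mul_zero, h0, Finset.filter_false, Finset.card_empty, Nat.cast_zero] at hm
    have : 0 < ε * L := by positivity
    linarith
  refine exists_progression_of_dilates hW hε hm0 hLc (hm.trans ?_)
  exact_mod_cast Finset.card_le_card fun l hl => Finset.mem_filter.mpr
    ⟨(Finset.mem_filter.mp hl).1, hA'A (Finset.mem_filter.mp hl).2⟩

/-- Roth's theorem in super smooth numbers. -/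
theorem roth_in_super_smooth_numbers :
    ∃ K₀ : ℕ, ∀ K : ℕ, K ≥ K₀ → ∀ δ : ℝ, δ > 0 → ∃ N₀ : ℕ, ∀ N : ℕ, N ≥ N₀ →
      ∀ A : Finset ℕ, A ⊆ smoothSet N ((Real.log N) ^ K) →
        (A.card : ℝ) ≥ δ * (Psi N ((Real.log N) ^ K) : ℝ) →
        ∃ n d : ℤ, d ≠ 0 ∧ (∃ a ∈ A, (a : ℤ) = n) ∧ (∃ a ∈ A, (a : ℤ) = n + d) ∧
          (∃ a ∈ A, (a : ℤ) = n + 2 * d) := by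
  exact ⟨4, fun K hK δ hδ => eventually_atTop.mp (eventually_exists_progression hK hδ)⟩
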